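/- Let t ∈ ℂ be transcendental over ℚ. Then dim_ℂ 𝒮_t = Σ_{λ ∈ H(m,n;r)} (f^λ)², the sum over partitions λ of r contained in the (m,n)-hook of the squares of the numbers of standard Young tableaux of shape λ. -/

import Mathlib

set_option synthInstance.maxHeartbeats 1000000
set_option maxHeartbeats 1000000

open scoped BigOperators Kronecker

section CommonDefs

variable {R : Type*} [CommRing R]

/-- ℤ₂-degree of the basis vector `v_{k+1}` (0-based index `k`): `0` if `k < m`, else `1`. -/
def deg (m : ℕ) {N : ℕ} (k : Fin N) : ℕ := if (k : ℕ) < m then 0 else 1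

/-- The sign `(−1)^{|v_k||v_l|}`. -/
def sgn (R : Type*) [CommRing R] (m : ℕ) {N : ℕ} (k l : Fin N) : R :=
  (-1 : R) ^ (deg m k * deg m l)

/-- Entries (row = input vector) of the operator `T` on `V ⊗ V`, where `x` plays the
role of `q` and `xinv` that of `q⁻¹`:  `T(v_k ⊗ v_k) = q·v_k ⊗ v_k` if `k ≤ m`,
`T(v_k ⊗ v_k) = −q⁻¹·v_k ⊗ v_k` if `k > m`,
`T(v_k ⊗ v_l) = (−1)^{|v_k||v_l|} v_l ⊗ v_k + (q−q⁻¹) v_k ⊗ v_l` if `k < l`, and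
`T(v_k ⊗ v_l) = (−1)^{|v_k||v_l|} v_l ⊗ v_k` if `k > l`. -/
def Tent (x xinv : R) (m : ℕ) {N : ℕ} (p p' : Fin N × Fin N) : R :=
  if p.1 = p.2 then (if (p.1 : ℕ) < m then x else -xinv) * (if p' = p then 1 else 0)
  else if (p.1 : ℕ) < (p.2 : ℕ) then
    sgn R m p.1 p.2 * (if p' = (p.2, p.1) then 1 else 0)
      + (x - xinv) * (if p' = p then 1 else 0)
  else sgn R m p.1 p.2 * (if p' = (p.2, p.1) then 1 else 0)

/-- Entries of the signed swap `P(v_k ⊗ v_l) = (−1)^{|v_k||v_l|} v_l ⊗ v_k`. -/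
def Pent (R : Type*) [CommRing R] (m : ℕ) {N : ℕ} (p p' : Fin N × Fin N) : R :=
  sgn R m p.1 p.2 * (if p' = (p.2, p.1) then 1 else 0)

/-- The operator `Id^{⊗ i} ⊗ E ⊗ Id^{⊗ (r−i−2)}` on `V^{⊗ r}` obtained from a two-site
operator `E` acting on the (0-based) tensor positions `i` and `i+1`. -/
def twoSiteOp {N : ℕ} (E : Fin N × Fin N → Fin N × Fin N → R) (r i : ℕ) (h : i + 1 < r) :
    Matrix (Fin r → Fin N) (Fin r → Fin N) R := fun a b =>
  E (a ⟨i, Nat.lt_of_succ_lt h⟩, a ⟨i + 1, h⟩) (b ⟨i, Nat.lt_of_succ_lt h⟩, b ⟨i + 1, h⟩) *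
    ∏ j ∈ Finset.univ \ ({⟨i, Nat.lt_of_succ_lt h⟩, ⟨i + 1, h⟩} : Finset (Fin r)),
      (if a j = b j then (1 : R) else 0)

/-- The Hecke operator `T_{i+1} = Id^{⊗ i} ⊗ T ⊗ Id^{⊗ (r−i−2)}` on `V^{⊗ r}`
(here `i` is the 0-based position of the first tensor factor it acts on). -/
def heckeOp (x xinv : R) (m : ℕ) {N : ℕ} (r i : ℕ) (h : i + 1 < r) :
    Matrix (Fin r → Fin N) (Fin r → Fin N) R :=
  twoSiteOp (Tent x xinv m) r i h

/-- The signed swap operator `P_{i+1} = Id^{⊗ i} ⊗ P ⊗ Id^{⊗ (r−i−2)}` on `V^{⊗ r}`. -/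
def swapOp (R : Type*) [CommRing R] (m : ℕ) {N : ℕ} (r i : ℕ) (h : i + 1 < r) :
    Matrix (Fin r → Fin N) (Fin r → Fin N) R :=
  twoSiteOp (Pent R m) r i h

/-- The parity operator `S v_j = (−1)^{|v_j|} v_j`. -/
def Smat (R : Type*) [CommRing R] (m : ℕ) {N : ℕ} : Matrix (Fin N) (Fin N) R :=
  fun a b => if a = b then (-1 : R) ^ deg m a else 0

/-- The diagonal operator `Q_b v_j = q^{δ_{bj}} v_j` (`x` playing the role of `q`, or of
`q⁻¹` for the inverse operator). -/
def Qmat (x : R) {N : ℕ} (b0 : Fin N) : Matrix (Fin N) (Fin N) R :=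
  fun a b => if a = b then (if a = b0 then x else 1) else 0

/-- `E_k v_{k+1} = v_k`, `E_k v_j = 0` otherwise (0-based `k`; row = input). -/
def Emat (R : Type*) [CommRing R] {N : ℕ} (k : ℕ) : Matrix (Fin N) (Fin N) R :=
  fun a b => if (a : ℕ) = k + 1 ∧ (b : ℕ) = k then 1 else 0

/-- `F_k v_k = v_{k+1}`, `F_k v_j = 0` otherwise (0-based `k`; row = input). -/
def Fmat (R : Type*) [CommRing R] {N : ℕ} (k : ℕ) : Matrix (Fin N) (Fin N) R :=
  fun a b => if (a : ℕ) = k ∧ (b : ℕ) = k + 1 then 1 else 0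

/-- The diagonal operator `D_k v_j = q^{s(k)δ_{kj} − s(k+1)δ_{k+1,j}} v_j`
(0-based `k`, so `s(k) = 1` iff `k < m`, and `s(k) = −1` otherwise). -/
def Dmat (x xinv : R) (m : ℕ) {N : ℕ} (k : ℕ) : Matrix (Fin N) (Fin N) R :=
  fun a b => if a = b then
    (if (a : ℕ) = k then (if k < m then x else xinv)
     else if (a : ℕ) = k + 1 then (if k + 1 < m then xinv else x) else 1)
  else 0

/-- The inverse `D_k⁻¹` of `Dmat` (obtained by exchanging `q` and `q⁻¹`). -/
def Dinvmat (x xinv : R) (m : ℕ) {N : ℕ} (k : ℕ) : Matrix (Fin N) (Fin N) R :=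
  Dmat xinv x m k

/-- `S^{p(k)}`, where `p(k) = 1` if the 0-based `k` satisfies `k + 1 = m` (the odd simple
root) and `p(k) = 0` otherwise. -/
def SPmat (R : Type*) [CommRing R] (m : ℕ) {N : ℕ} (k : ℕ) : Matrix (Fin N) (Fin N) R :=
  if k + 1 = m then Smat R m else 1

/-- Kronecker (tensor) product of `r` one-site operators, as a matrix on `V^{⊗ r}`. -/
def kron {N r : ℕ} (M : Fin r → Matrix (Fin N) (Fin N) R) :
    Matrix (Fin r → Fin N) (Fin r → Fin N) R :=
  fun a b => ∏ j, M j (a j) (b j)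

/-- `ρ_r(σ) = S^{⊗ r}`. -/
def rhoSigma (R : Type*) [CommRing R] (m : ℕ) {N : ℕ} (r : ℕ) :
    Matrix (Fin r → Fin N) (Fin r → Fin N) R :=
  kron fun _ => Smat R m

/-- `ρ_r(q^{δ_b}) = Q_b^{⊗ r}` (and its inverse, substituting `q⁻¹` for `x`). -/
def rhoQ (x : R) {N : ℕ} (r : ℕ) (b0 : Fin N) :
    Matrix (Fin r → Fin N) (Fin r → Fin N) R :=
  kron fun _ => Qmat x b0

/-- `ρ_r(e_k) = Σ_{j=1}^{r} (S^{p(k)})^{⊗(j−1)} ⊗ E_k ⊗ (D_k^{−1})^{⊗(r−j)}`. -/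
def rhoE (x xinv : R) (m : ℕ) {N : ℕ} (r : ℕ) (k : ℕ) :
    Matrix (Fin r → Fin N) (Fin r → Fin N) R :=
  ∑ p : Fin r, kron fun j =>
    if j < p then SPmat R m k else if j = p then Emat R k else Dinvmat x xinv m k

/-- `ρ_r(f_k) = Σ_{j=1}^{r} (S^{p(k)}D_k)^{⊗(j−1)} ⊗ F_k ⊗ Id^{⊗(r−j)}`. -/
def rhoF (x xinv : R) (m : ℕ) {N : ℕ} (r : ℕ) (k : ℕ) :
    Matrix (Fin r → Fin N) (Fin r → Fin N) R :=
  ∑ p : Fin r, kron fun j =>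
    if j < p then SPmat R m k * Dmat x xinv m k else if j = p then Fmat R k else 1

/-- The generators `T_1, …, T_{r−1}` of the image of the sign `q`-permutation
representation of the Iwahori–Hecke algebra on `V^{⊗ r}`. -/
def heckeGens (x xinv : R) (m : ℕ) {N : ℕ} (r : ℕ) :
    Set (Matrix (Fin r → Fin N) (Fin r → Fin N) R) :=
  {M | ∃ (i : ℕ) (h : i + 1 < r), M = heckeOp x xinv m r i h}

/-- The signed-swap generators `P_1, …, P_{r−1}` (the `q → 1` specialization). -/
def swapGens (R : Type*) [CommRing R] (m : ℕ) {N : ℕ} (r : ℕ) :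
    Set (Matrix (Fin r → Fin N) (Fin r → Fin N) R) :=
  {M | ∃ (i : ℕ) (h : i + 1 < r), M = swapOp R m r i h}

/-- The generators `ρ_r(σ)`, `ρ_r(q^{± δ_b})` (`1 ≤ b ≤ N`), `ρ_r(e_k)`, `ρ_r(f_k)`
(`1 ≤ k ≤ N−1`) of the image of the vector representation of `U_q^σ(gl(m,n))`. -/
def quantumGens (x xinv : R) (m : ℕ) {N : ℕ} (r : ℕ) :
    Set (Matrix (Fin r → Fin N) (Fin r → Fin N) R) :=
  {rhoSigma R m r} ∪ (Set.range fun b : Fin N => rhoQ x r b)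
    ∪ (Set.range fun b : Fin N => rhoQ xinv r b)
    ∪ (Set.range fun k : Fin (N - 1) => rhoE x xinv m r (k : ℕ))
    ∪ (Set.range fun k : Fin (N - 1) => rhoF x xinv m r (k : ℕ))

end CommonDefs

/-- Cell membership in the Young diagram of a partition `lam` of `r`: the (0-based) cell
`(i, j)` lies in the diagram iff more than `i` parts of `lam` exceed `j`
(equivalently, `j < λ_{i+1}`). -/
def cellIn {r : ℕ} (lam : Nat.Partition r) (c : ℕ × ℕ) : Prop :=
  c.1 < (lam.parts.filter fun p => c.2 < p).card

/-- `f^λ`: the number of standard Young tableaux of shape `lam`, i.e. bijective fillings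
of the cells of the Young diagram of `lam` by `1, …, r` that strictly increase along
each row and down each column. -/
noncomputable def fSYT {r : ℕ} (lam : Nat.Partition r) : ℕ :=
  Nat.card {f : {c : ℕ × ℕ // cellIn lam c} → Fin r //
    Function.Bijective f ∧
      (∀ c d : {c : ℕ × ℕ // cellIn lam c}, c.1.1 = d.1.1 → c.1.2 < d.1.2 → f c < f d) ∧
      (∀ c d : {c : ℕ × ℕ // cellIn lam c}, c.1.2 = d.1.2 → c.1.1 < d.1.1 → f c < f d)}

/-- The `(m,n)`-hook `H(m,n;r)`: partitions `λ = (λ_1 ≥ λ_2 ≥ …)` of `r` with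
`λ_j ≤ n` for all `j > m`, i.e. at most `m` parts exceed `n`. -/
def hookFinset (m n r : ℕ) : Finset (Nat.Partition r) :=
  Finset.univ.filter fun lam => (lam.parts.filter fun p => n < p).card ≤ m

/-- The specialized algebra `𝒮_t ⊆ Mat_{(m+n)^r}(ℂ)`, generated by the Hecke operators
with `q` replaced by the nonzero complex number `t`. -/
noncomputable def St (t : ℂ) (m n r : ℕ) :
    Subalgebra ℂ (Matrix (Fin r → Fin (m + n)) (Fin r → Fin (m + n)) ℂ) :=
  Algebra.adjoin ℂ (heckeGens t t⁻¹ m (N := m + n) r)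

/-- The specialized algebra `𝒢_t ⊆ Mat_{(m+n)^r}(ℂ)`, generated by the operators of the
vector representation with `q` replaced by the nonzero complex number `t`. -/
noncomputable def Gt (t : ℂ) (m n r : ℕ) :
    Subalgebra ℂ (Matrix (Fin r → Fin (m + n)) (Fin r → Fin (m + n)) ℂ) :=
  Algebra.adjoin ℂ (quantumGens t t⁻¹ m (N := m + n) r)

namespace HookSchurWeyl

/-- Exchange the entries at positions `i` and `i + 1` of a word. -/
def sw {R : ℕ} {α : Type*} (i : Fin R) (a : Fin (R + 1) → α) : Fin (R + 1) → α :=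
  a ∘ Equiv.swap i.castSucc i.succ

section Swap

variable {R : ℕ} {α : Type*}

@[simp] lemma sw_castSucc (i : Fin R) (a : Fin (R + 1) → α) : sw i a i.castSucc = a i.succ := by
  simp [sw]

@[simp] lemma sw_succ (i : Fin R) (a : Fin (R + 1) → α) : sw i a i.succ = a i.castSucc := by
  simp [sw]

lemma sw_of_ne (i : Fin R) (a : Fin (R + 1) → α) {k : Fin (R + 1)} (h₁ : k ≠ i.castSucc)
    (h₂ : k ≠ i.succ) : sw i a k = a k := by
  simp [sw, Equiv.swap_apply_of_ne_of_ne h₁ h₂]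

@[simp] lemma sw_sw (i : Fin R) (a : Fin (R + 1) → α) : sw i (sw i a) = a := by
  funext k; simp [sw]

lemma castSucc_eq_succ {i j : Fin R} (h : (j : ℕ) = i + 1) : j.castSucc = i.succ := by
  ext; simp [h]

lemma sw_apply_far (i : Fin R) (a : Fin (R + 1) → α) {k : Fin (R + 1)}
    (h : (k : ℕ) < i ∨ (i : ℕ) + 1 < k) : sw i a k = a k := by
  apply sw_of_ne <;> (intro hk; subst hk; simp at h)

lemma sw_comm {i j : Fin R} (h : (i : ℕ) + 1 < j) (a : Fin (R + 1) → α) :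
    sw i (sw j a) = sw j (sw i a) := by
  funext k
  by_cases h₁ : k = i.castSucc
  · subst h₁
    rw [sw_castSucc, sw_apply_far j a (by left; simpa using h),
      sw_apply_far j _ (by left; simp; omega), sw_castSucc]
  by_cases h₂ : k = i.succ
  · subst h₂
    rw [sw_succ, sw_apply_far j a (by left; simp; omega),
      sw_apply_far j _ (by left; simp; omega), sw_succ]
  rw [sw_of_ne i _ h₁ h₂]
  by_cases h₃ : k = j.castSucc
  · subst h₃
    rw [sw_castSucc, sw_castSucc, sw_apply_far i a (by right; simp; omega)]
  by_cases h₄ : k = j.succ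
  · subst h₄
    rw [sw_succ, sw_succ, sw_apply_far i a (by right; simp; omega)]
  rw [sw_of_ne j _ h₃ h₄, sw_of_ne j _ h₃ h₄, sw_of_ne i _ h₁ h₂]

section Triple

variable {i j : Fin R}

lemma sw_left_third (h : (j : ℕ) = i + 1) (a : Fin (R + 1) → α) :
    sw i a j.succ = a j.succ :=
  sw_apply_far i a (by right; simp; omega)

lemma sw_right_first (h : (j : ℕ) = i + 1) (a : Fin (R + 1) → α) :
    sw j a i.castSucc = a i.castSucc :=
  sw_apply_far j a (by left; simp; omega)

lemma sw_right_mid (h : (j : ℕ) = i + 1) (a : Fin (R + 1) → α) :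
    sw j a i.succ = a j.succ := by
  rw [← castSucc_eq_succ h, sw_castSucc]

lemma sw_left_mid (h : (j : ℕ) = i + 1) (a : Fin (R + 1) → α) :
    sw i a j.castSucc = a i.castSucc := by
  rw [castSucc_eq_succ h, sw_succ]

lemma sw_braid (h : (j : ℕ) = i + 1) (a : Fin (R + 1) → α) :
    sw i (sw j (sw i a)) = sw j (sw i (sw j a)) := by
  have e := castSucc_eq_succ h
  funext k
  by_cases h₁ : k = i.castSucc
  · subst h₁
    rw [sw_castSucc, sw_right_mid h, sw_left_third h, sw_right_first h, sw_castSucc,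
      sw_right_mid h]
  by_cases h₂ : k = i.succ
  · subst h₂
    rw [sw_succ, sw_right_first h, sw_castSucc, sw_right_mid h, sw_left_third h, sw_succ, e]
  by_cases h₃ : k = j.succ
  · subst h₃
    rw [sw_left_third h, sw_succ, sw_left_mid h, sw_succ, sw_left_mid h, sw_right_first h]
  have h₄ : k ≠ j.castSucc := by rwa [e]
  rw [sw_of_ne i _ h₁ h₂, sw_of_ne j _ h₄ h₃, sw_of_ne i _ h₁ h₂, sw_of_ne j _ h₄ h₃,
    sw_of_ne i _ h₁ h₂, sw_of_ne j _ h₄ h₃]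

end Triple

end Swap

/-- The quadratic, braid and commutation relations of the Iwahori–Hecke algebra. -/
structure HeckeRel {R : ℕ} {A : Type*} [Ring A] [Algebra ℂ A] (z : ℂ) (T : Fin R → A) : Prop where
  quad : ∀ i, T i * T i = z • T i + 1
  braid : ∀ i j : Fin R, (j : ℕ) = i + 1 → T i * T j * T i = T j * T i * T j
  comm : ∀ i j : Fin R, (i : ℕ) + 1 < j → T i * T j = T j * T i

section LocalOperator

variable {R : ℕ} {α : Type*}

/-- The operator on functions of words which mixes the values at a word and at its `i`-th
exchange, with coefficients depending on the two letters exchanged. -/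
def lop (A B : α → α → ℂ) (i : Fin R) (f : (Fin (R + 1) → α) → ℂ) :
    (Fin (R + 1) → α) → ℂ := fun a =>
  A (a i.castSucc) (a i.succ) * f a + B (a i.castSucc) (a i.succ) * f (sw i a)

variable {A B : α → α → ℂ}

lemma lop_quad {z : ℂ} (i : Fin R) (f : (Fin (R + 1) → α) → ℂ) (a : Fin (R + 1) → α)
    (h₁ : A (a i.castSucc) (a i.succ) ^ 2
      + B (a i.castSucc) (a i.succ) * B (a i.succ) (a i.castSucc)
        = z * A (a i.castSucc) (a i.succ) + 1)
    (h₂ : B (a i.castSucc) (a i.succ) *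
      (A (a i.castSucc) (a i.succ) + A (a i.succ) (a i.castSucc) - z) = 0) :
    lop A B i (lop A B i f) a = z * lop A B i f a + f a := by
  simp only [lop, sw_castSucc, sw_succ, sw_sw]
  linear_combination f a * h₁ + f (sw i a) * h₂

lemma lop_comm {i j : Fin R} (h : (i : ℕ) + 1 < j) (f : (Fin (R + 1) → α) → ℂ)
    (a : Fin (R + 1) → α) : lop A B i (lop A B j f) a = lop A B j (lop A B i f) a := by
  simp only [lop, sw_comm h]
  rw [sw_apply_far i a (k := j.castSucc) (by right; simp; omega),
    sw_apply_far i a (k := j.succ) (by right; simp; omega),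
    sw_apply_far j a (k := i.castSucc) (by left; simp; omega),
    sw_apply_far j a (k := i.succ) (by left; simp; omega)]
  ring

lemma lop_braid {i j : Fin R} (h : (j : ℕ) = i + 1) (f : (Fin (R + 1) → α) → ℂ)
    (a : Fin (R + 1) → α) {x y w : α} (hx : a i.castSucc = x) (hy : a i.succ = y)
    (hw : a j.succ = w)
    (h₁ : A x y * A y w * A x y + B x y * A x w * B y x
      = A y w * A x y * A y w + B y w * A x w * B w y)
    (h₂ : B x y * (A x w * A y x + A x y * A y w - A y w * A x w) = 0)
    (h₃ : B y w * (A x w * A w y + A y w * A x y - A x y * A x w) = 0) :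
    lop A B i (lop A B j (lop A B i f)) a = lop A B j (lop A B i (lop A B j f)) a := by
  have e := castSucc_eq_succ h
  simp only [lop, sw_castSucc, sw_succ, sw_sw, sw_left_third h, sw_right_first h, sw_right_mid h,
    e, hx, hy, hw, sw_braid h]
  linear_combination f a * h₁ + f (sw i a) * h₂ - f (sw j a) * h₃

end LocalOperator

section Weight

variable {R : ℕ}

/-- The statistic `∑ k · a_k` of a word, which grows when a descent is removed. -/
def wt (a : Fin (R + 1) → ℕ) : ℕ := ∑ k : Fin (R + 1), (k : ℕ) * a k

lemma wt_sw_lt {i : Fin R} {a : Fin (R + 1) → ℕ} (h : a i.castSucc < a i.succ) :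
    wt (sw i a) < wt a := by
  have hne : i.castSucc ≠ i.succ := i.castSucc_lt_succ.ne
  have key : ∀ b : Fin (R + 1) → ℕ, wt b = (i : ℕ) * b i.castSucc + ((i : ℕ) + 1) * b i.succ +
      ∑ k ∈ (Finset.univ.erase i.castSucc).erase i.succ, (k : ℕ) * b k := by
    intro b
    rw [wt, ← Finset.add_sum_erase _ _ (Finset.mem_univ i.castSucc),
      ← Finset.add_sum_erase (Finset.univ.erase i.castSucc) _
        (Finset.mem_erase.2 ⟨hne.symm, Finset.mem_univ i.succ⟩), ← add_assoc]
    simp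
  have hrest : ∑ k ∈ (Finset.univ.erase i.castSucc).erase i.succ, (k : ℕ) * sw i a k
      = ∑ k ∈ (Finset.univ.erase i.castSucc).erase i.succ, (k : ℕ) * a k := by
    refine Finset.sum_congr rfl fun k hk => ?_
    simp only [Finset.mem_erase, Finset.mem_univ, and_true] at hk
    rw [sw_of_ne i a hk.2 hk.1]
  rw [key (sw i a), key a, hrest, sw_castSucc, sw_succ]
  nlinarith

end Weight

section WordMap

variable {R N : ℕ} {M : Type*} [AddCommGroup M] [Module ℂ M]

/-- Extend a family of vectors indexed by weakly decreasing words to all words, by applying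
the operators `T i` along ascents. -/
noncomputable def wordMap (s : Fin N → Fin N → ℂ) (T : Fin R → Module.End ℂ M)
    (u : (Fin (R + 1) → Fin N) → M) (a : Fin (R + 1) → Fin N) : M :=
  open Classical in
  if h : ∃ i : Fin R, a i.castSucc < a i.succ then
    s (a h.choose.castSucc) (a h.choose.succ) • T h.choose (wordMap s T u (sw h.choose a))
  else u a
termination_by wt (fun k => (a k : ℕ))
decreasing_by
  exact wt_sw_lt (a := fun k => (a k : ℕ)) (Fin.lt_def.1 h.choose_spec)

variable {z : ℂ} {s : Fin N → Fin N → ℂ} {χ : Fin N → ℂ} {T : Fin R → Module.End ℂ M}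
  {u : (Fin (R + 1) → Fin N) → M}

lemma wordMap_antitone {a : Fin (R + 1) → Fin N} (ha : Antitone a) : wordMap s T u a = u a := by
  rw [wordMap, dif_neg]
  rintro ⟨i, hi⟩
  exact absurd hi (not_lt.2 (ha i.castSucc_lt_succ.le))

lemma HeckeRel.comm_apply (hT : HeckeRel z T) {i j : Fin R} (h : (i : ℕ) + 1 < j) (v : M) :
    T i (T j v) = T j (T i v) := by
  rw [← Module.End.mul_apply, hT.comm i j h, Module.End.mul_apply]

lemma HeckeRel.braid_apply (hT : HeckeRel z T) {i j : Fin R} (h : (j : ℕ) = i + 1) (v : M) :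
    T i (T j (T i v)) = T j (T i (T j v)) := by
  have := congrArg (fun f : Module.End ℂ M => f v) (hT.braid i j h)
  simpa [mul_assoc] using this

lemma HeckeRel.quad_apply (hT : HeckeRel z T) (i : Fin R) (v : M) :
    T i (T i v) = z • T i v + v := by
  rw [← Module.End.mul_apply, hT.quad]
  simp

/-- The value of `wordMap` may be computed along any ascent. -/
lemma wordMap_ascent (hT : HeckeRel z T) (a : Fin (R + 1) → Fin N) (i : Fin R)
    (hi : a i.castSucc < a i.succ) :
    wordMap s T u a = s (a i.castSucc) (a i.succ) • T i (wordMap s T u (sw i a)) := by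
  induction hn : wt (fun k => (a k : ℕ)) using Nat.strong_induction_on generalizing a i with
  | _ n ih =>
  have hlt : ∀ (b : Fin (R + 1) → Fin N) (i : Fin R), b i.castSucc < b i.succ →
      wt (fun k => ((sw i b) k).val) < wt (fun k => (b k : ℕ)) := fun b i h =>
    wt_sw_lt (a := fun k => (b k : ℕ)) (Fin.lt_def.1 h)
  have far : ∀ i j : Fin R, a i.castSucc < a i.succ → a j.castSucc < a j.succ → (i : ℕ) + 1 < j →
      s (a i.castSucc) (a i.succ) • T i (wordMap s T u (sw i a))
        = s (a j.castSucc) (a j.succ) • T j (wordMap s T u (sw j a)) := by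
    intro i j hi hj hij
    have e1 : sw i a j.castSucc = a j.castSucc := sw_apply_far i a (by right; simp; omega)
    have e2 : sw i a j.succ = a j.succ := sw_apply_far i a (by right; simp; omega)
    have e3 : sw j a i.castSucc = a i.castSucc := sw_apply_far j a (by left; simp; omega)
    have e4 : sw j a i.succ = a i.succ := sw_apply_far j a (by left; simp; omega)
    rw [ih _ (hn ▸ hlt a i hi) (sw i a) j (by rwa [e1, e2]) rfl,
      ih _ (hn ▸ hlt a j hj) (sw j a) i (by rwa [e3, e4]) rfl, e1, e2, e3, e4, sw_comm hij,
      map_smul, map_smul, hT.comm_apply hij, smul_comm]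
  have near : ∀ i j : Fin R, a i.castSucc < a i.succ → a j.castSucc < a j.succ → (j : ℕ) = i + 1 →
      s (a i.castSucc) (a i.succ) • T i (wordMap s T u (sw i a))
        = s (a j.castSucc) (a j.succ) • T j (wordMap s T u (sw j a)) := by
    intro i j hi hj hij
    have e := castSucc_eq_succ hij
    have hj' : a i.succ < a j.succ := by rwa [e] at hj
    have a1 : sw i a j.castSucc < sw i a j.succ := by
      rw [sw_left_mid hij, sw_left_third hij]; exact hi.trans hj'
    have a2 : sw j (sw i a) i.castSucc < sw j (sw i a) i.succ := by
      rw [sw_right_first hij, sw_right_mid hij, sw_castSucc, sw_left_third hij]; exact hj'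
    have b1 : sw j a i.castSucc < sw j a i.succ := by
      rw [sw_right_first hij, sw_right_mid hij]; exact hi.trans hj'
    have b2 : sw i (sw j a) j.castSucc < sw i (sw j a) j.succ := by
      rw [sw_left_mid hij, sw_left_third hij, sw_right_first hij, sw_succ, e]; exact hi
    have l1 := hlt a i hi
    have l2 := hlt _ j a1
    have m1 := hlt a j hj
    have m2 := hlt _ i b1
    rw [ih _ (hn ▸ l1) (sw i a) j a1 rfl, ih _ (hn ▸ l2.trans l1) _ i a2 rfl,
      ih _ (hn ▸ m1) (sw j a) i b1 rfl, ih _ (hn ▸ m2.trans m1) _ j b2 rfl, sw_braid hij]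
    simp only [sw_left_third hij, sw_right_first hij, sw_right_mid hij,
      sw_castSucc, sw_succ, e, map_smul, hT.braid_apply hij, smul_smul]
    congr 1
    ring
  have hex : ∃ i : Fin R, a i.castSucc < a i.succ := ⟨i, hi⟩
  have hdef : wordMap s T u a = s (a hex.choose.castSucc) (a hex.choose.succ) •
      T hex.choose (wordMap s T u (sw hex.choose a)) := by
    rw [wordMap, dif_pos hex]
  rw [hdef]
  have hj := hex.choose_spec
  generalize hex.choose = j at hj ⊢
  rcases lt_trichotomy (i : ℕ) j with h | h | h
  · rcases (Nat.succ_le_of_lt h).lt_or_eq with hs | hs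
    · exact (far i j hi hj hs).symm
    · exact (near i j hi hj hs.symm).symm
  · rw [Fin.ext h]
  · rcases (Nat.succ_le_of_lt h).lt_or_eq with hs | hs
    · exact far j i hj hi hs
    · exact near j i hj hi hs.symm

/-- If the initial vectors are eigenvectors for equal neighbours, so are all values. -/
lemma wordMap_eq (hT : HeckeRel z T)
    (hu : ∀ a, Antitone a → ∀ i : Fin R, a i.castSucc = a i.succ →
      T i (u a) = χ (a i.castSucc) • u a)
    (a : Fin (R + 1) → Fin N) (i : Fin R) (hi : a i.castSucc = a i.succ) :
    T i (wordMap s T u a) = χ (a i.castSucc) • wordMap s T u a := by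
  induction hn : wt (fun k => (a k : ℕ)) using Nat.strong_induction_on generalizing a i with
  | _ n ih =>
  have hlt : ∀ (b : Fin (R + 1) → Fin N) (i : Fin R), b i.castSucc < b i.succ →
      wt (fun k => ((sw i b) k).val) < wt (fun k => (b k : ℕ)) := fun b i h =>
    wt_sw_lt (a := fun k => (b k : ℕ)) (Fin.lt_def.1 h)
  by_cases hex : ∃ j : Fin R, a j.castSucc < a j.succ
  swap
  · push Not at hex
    have ha : Antitone a := Fin.antitone_iff_succ_le.2 hex
    rw [wordMap_antitone ha]
    exact hu a ha i hi
  obtain ⟨j, hj⟩ := hex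
  have l1 := hlt a j hj
  rcases lt_trichotomy (i : ℕ) j with h | h | h
  · rcases (Nat.succ_le_of_lt h).lt_or_eq with hij | hij
    · have e3 : sw j a i.castSucc = a i.castSucc := sw_apply_far j a (by left; simp; omega)
      have e4 : sw j a i.succ = a i.succ := sw_apply_far j a (by left; simp; omega)
      rw [wordMap_ascent hT a j hj, map_smul, hT.comm_apply hij,
        ih _ (hn ▸ l1) (sw j a) i (by rw [e3, e4, hi]) rfl, e3, map_smul, smul_comm]
    · have hij : (j : ℕ) = i + 1 := hij.symm
      have e := castSucc_eq_succ hij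
      have hj' : a i.succ < a j.succ := by rwa [e] at hj
      have b1 : sw j a i.castSucc < sw j a i.succ := by
        rw [sw_right_first hij, sw_right_mid hij, hi]; exact hj'
      have b2 : sw i (sw j a) j.castSucc = sw i (sw j a) j.succ := by
        rw [sw_left_mid hij, sw_left_third hij, sw_right_first hij, sw_succ, e, hi]
      rw [wordMap_ascent hT a j hj, wordMap_ascent hT _ i b1]
      simp only [map_smul]
      rw [hT.braid_apply hij, ih _ (hn ▸ (hlt _ i b1).trans l1) _ j b2 rfl, sw_left_mid hij,
        sw_right_first hij]
      simp only [map_smul]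
      rw [smul_comm (χ _), smul_comm (χ _)]
  · rw [Fin.ext h] at hi
    exact absurd hj (by rw [hi]; exact lt_irrefl _)
  · rcases (Nat.succ_le_of_lt h).lt_or_eq with hij | hij
    · have e1 : sw j a i.castSucc = a i.castSucc := sw_apply_far j a (by right; simp; omega)
      have e2 : sw j a i.succ = a i.succ := sw_apply_far j a (by right; simp; omega)
      rw [wordMap_ascent hT a j hj, map_smul, ← hT.comm_apply hij,
        ih _ (hn ▸ l1) (sw j a) i (by rw [e1, e2, hi]) rfl, e1, map_smul, smul_comm]
    · have hij : (i : ℕ) = j + 1 := hij.symm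
      have e := castSucc_eq_succ hij
      rw [e] at hi
      have b1 : sw j a i.castSucc < sw j a i.succ := by
        rw [sw_left_mid hij, sw_left_third hij, ← hi]; exact hj
      have b2 : sw i (sw j a) j.castSucc = sw i (sw j a) j.succ := by
        rw [sw_right_first hij, sw_right_mid hij, sw_left_third hij, sw_castSucc, hi]
      rw [wordMap_ascent hT a j hj, wordMap_ascent hT _ i b1]
      simp only [map_smul]
      rw [← hT.braid_apply hij, ih _ (hn ▸ (hlt _ i b1).trans l1) _ j b2 rfl, sw_right_first hij,
        sw_castSucc, e]
      simp only [map_smul]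
      rw [smul_comm (χ _), smul_comm (χ _)]

/-- The diagonal coefficient of the two-site operator on the letters `k, l`. -/
def coefA (z : ℂ) (χ : Fin N → ℂ) (k l : Fin N) : ℂ :=
  if k < l then z else if k = l then χ k else 0

/-- The off-diagonal coefficient of the two-site operator on the letters `k, l`. -/
def coefB (s : Fin N → Fin N → ℂ) (k l : Fin N) : ℂ := if k = l then 0 else s k l

lemma wordMap_apply (hT : HeckeRel z T) (hs : ∀ k l, s k l * s k l = 1)
    (hsymm : ∀ k l, s k l = s l k)
    (hu : ∀ a, Antitone a → ∀ i : Fin R, a i.castSucc = a i.succ →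
      T i (u a) = χ (a i.castSucc) • u a)
    (a : Fin (R + 1) → Fin N) (i : Fin R) :
    T i (wordMap s T u a) = coefA z χ (a i.castSucc) (a i.succ) • wordMap s T u a
      + coefB s (a i.castSucc) (a i.succ) • wordMap s T u (sw i a) := by
  rcases lt_trichotomy (a i.castSucc) (a i.succ) with h | h | h
  · rw [wordMap_ascent hT a i h, map_smul, hT.quad_apply, smul_add, coefA, if_pos h, coefB,
      if_neg h.ne, smul_comm z]
  · rw [wordMap_eq hT hu a i h, coefA, coefB, if_neg h.not_lt, if_pos h, if_pos h]
    simp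
  · rw [wordMap_ascent hT (sw i a) i (by simpa using h), sw_sw, coefA, coefB, if_neg h.not_gt,
      if_neg h.ne', if_neg h.ne', smul_smul, sw_castSucc, sw_succ, hsymm (a i.succ), hs]
    simp

end WordMap

section Orbit

variable {R : ℕ} {M : Type*} [AddCommGroup M] [Module ℂ M] {z : ℂ} {T : Fin R → Module.End ℂ M}

/-- Every vector of a module over the Hecke algebra lies in a submodule of dimension at most
`(R + 1)!`. -/
lemma exists_stable_finrank_le (hT : HeckeRel z T) (v : M) :
    ∃ S : Submodule ℂ M, v ∈ S ∧ (∀ i, ∀ x ∈ S, T i x ∈ S) ∧ FiniteDimensional ℂ S ∧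
      Module.finrank ℂ S ≤ (R + 1).factorial := by
  classical
  let u : (Fin (R + 1) → Fin (R + 1)) → M := fun b => if Function.Injective b then v else 0
  let Φ := wordMap (fun _ _ => (1 : ℂ)) T u
  have hu : ∀ a, Antitone a → ∀ i : Fin R, a i.castSucc = a i.succ →
      T i (u a) = (fun _ => (0 : ℂ)) (a i.castSucc) • u a := by
    intro a _ i hi
    have : ¬ Function.Injective a := fun h => i.castSucc_lt_succ.ne (h hi)
    simp [u, this]
  have hΦ := wordMap_apply hT (s := fun _ _ => (1 : ℂ)) (χ := fun _ => 0) (by simp) (by simp) hu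
  refine ⟨Submodule.span ℂ (Set.range fun σ : Equiv.Perm (Fin (R + 1)) => Φ σ), ?_, ?_,
    FiniteDimensional.span_of_finite ℂ (Set.finite_range _), ?_⟩
  · have h : Φ Fin.revPerm = v := by
      change wordMap _ _ _ _ = _
      rw [wordMap_antitone (fun x y h => by simpa using h)]
      simp only [u]
      rw [if_pos Fin.revPerm.injective]
    rw [← h]
    exact Submodule.subset_span ⟨_, rfl⟩
  · intro i x hx
    induction hx using Submodule.span_induction with
    | zero => simp
    | add x y _ _ hx hy => rw [map_add]; exact add_mem hx hy
    | smul c x _ hx => rw [map_smul]; exact Submodule.smul_mem _ _ hx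
    | mem x hx =>
      obtain ⟨σ, rfl⟩ := hx
      simp only [Φ]
      rw [hΦ]
      exact add_mem (Submodule.smul_mem _ _ (Submodule.subset_span ⟨σ, rfl⟩))
        (Submodule.smul_mem _ _ (Submodule.subset_span
          ⟨σ * Equiv.swap i.castSucc i.succ, rfl⟩))
  · refine (finrank_range_le_card _).trans ?_
    rw [Fintype.card_perm, Fintype.card_fin]

end Orbit

section WordOperators

variable {R N : ℕ}

/-- `lop` as a linear endomorphism. -/
def lopEnd {α : Type*} (A B : α → α → ℂ) (i : Fin R) :
    Module.End ℂ ((Fin (R + 1) → α) → ℂ) where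
  toFun := lop A B i
  map_add' f g := by funext a; simp only [lop, Pi.add_apply]; ring
  map_smul' c f := by
    funext a; simp only [lop, Pi.smul_apply, smul_eq_mul, RingHom.id_apply]; ring

lemma lopEnd_single (A B : Fin N → Fin N → ℂ) (hB : ∀ k l, B k l = B l k) (i : Fin R)
    (a : Fin (R + 1) → Fin N) :
    lopEnd A B i (Pi.single a 1) = A (a i.castSucc) (a i.succ) • Pi.single a 1
      + B (a i.castSucc) (a i.succ) • Pi.single (sw i a) 1 := by
  funext c
  have hc : sw i c = a ↔ c = sw i a := ⟨fun h => by rw [← h, sw_sw], fun h => by rw [h, sw_sw]⟩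
  simp only [lopEnd, LinearMap.coe_mk, AddHom.coe_mk, lop, Pi.add_apply, Pi.smul_apply,
    Pi.single_apply, smul_eq_mul, hc]
  congr 1
  · by_cases h : c = a
    · rw [h]
    · simp [h]
  · by_cases h : c = sw i a
    · rw [h, sw_castSucc, sw_succ, hB]
    · simp [h]

lemma lopEnd_heckeRel {A B : Fin N → Fin N → ℂ} {z : ℂ}
    (hq : ∀ x y, A x y ^ 2 + B x y * B y x = z * A x y + 1)
    (hq' : ∀ x y, B x y * (A x y + A y x - z) = 0)
    (h₁ : ∀ x y w, (A x y - A y w) * (A x y * A y w + z * A x w - (A x y + A y w) * A x w) = 0)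
    (h₂ : ∀ x y w, B x y * (A x w * A y x + A x y * A y w - A y w * A x w) = 0)
    (h₃ : ∀ x y w, B y w * (A x w * A w y + A y w * A x y - A x y * A x w) = 0) :
    HeckeRel z (lopEnd (R := R) A B) where
  quad i := by
    refine LinearMap.ext fun f => funext fun a => ?_
    simpa [lopEnd] using lop_quad i f a (hq _ _) (hq' _ _)
  braid i j h := by
    refine LinearMap.ext fun f => funext fun a => ?_
    simpa [lopEnd] using lop_braid h f a rfl rfl rfl
      (by linear_combination h₁ (a i.castSucc) (a i.succ) (a j.succ)
            + A (a i.castSucc) (a j.succ) * hq (a i.castSucc) (a i.succ)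
            - A (a i.castSucc) (a j.succ) * hq (a i.succ) (a j.succ)) (h₂ _ _ _) (h₃ _ _ _)
  comm i j h := by
    refine LinearMap.ext fun f => funext fun a => ?_
    simpa [lopEnd] using lop_comm h f a

/-- The eigenvalue of the two-site Hecke operator on `w_k ⊗ w_k`. -/
noncomputable def eig (t : ℂ) (m : ℕ) {N : ℕ} (k : Fin N) : ℂ := if (k : ℕ) < m then t else -t⁻¹

lemma sgn_mul_self (m : ℕ) (k l : Fin N) : sgn ℂ m k l * sgn ℂ m k l = 1 := by
  rw [sgn, ← mul_pow]; simp

lemma sgn_comm (m : ℕ) (k l : Fin N) : sgn ℂ m k l = sgn ℂ m l k := by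
  rw [sgn, sgn, mul_comm]

/-- The Hecke operator on tensor space, as an endomorphism. -/
noncomputable def opW (t : ℂ) (m N : ℕ) (i : Fin R) :
    Module.End ℂ ((Fin (R + 1) → Fin N) → ℂ) :=
  lopEnd (coefA (t - t⁻¹) (eig t m)) (coefB (sgn ℂ m)) i

lemma opW_heckeRel {t : ℂ} (ht : t ≠ 0) (m N : ℕ) :
    HeckeRel (t - t⁻¹) (opW (R := R) t m N) := by
  have hχ : ∀ k : Fin N, eig t m k ^ 2 = (t - t⁻¹) * eig t m k + 1 := by
    intro k
    unfold eig
    split_ifs <;> field_simp <;> ring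
  have hs := sgn_mul_self (N := N) m
  have hc := sgn_comm (N := N) m
  have hs' : ∀ k l : Fin N, sgn ℂ m k l * sgn ℂ m l k = 1 := fun k l => by rw [hc l k, hs]
  apply lopEnd_heckeRel
  · intro x y
    rcases lt_trichotomy x y with h | h | h
    · simp [coefA, coefB, h, h.ne, h.ne', hs']; ring
    · simp [coefA, coefB, h, hχ]
    · simp [coefA, coefB, h.ne, h.ne', h.not_gt, hs']
  · intro x y
    rcases lt_trichotomy x y with h | h | h
    · simp [coefA, coefB, h, h.ne, h.ne', h.not_gt]
    · simp [coefB, h]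
    · simp [coefA, coefB, h, h.ne', h.not_gt]
  all_goals
    intro x y w
    rcases lt_trichotomy x y with h | h | h <;> rcases lt_trichotomy y w with h' | h' | h' <;>
    rcases lt_trichotomy x w with h'' | h'' | h'' <;>
    first
    | (exfalso; order)
    | (subst_vars
       simp only [coefA, coefB, *, ne_of_lt, ne_of_gt, not_lt_of_gt, lt_irrefl, if_true, if_false]
       ring)

end WordOperators

section WordMatrix

variable {R N : ℕ}

lemma twoSiteOp_apply (E : Fin N × Fin N → Fin N × Fin N → ℂ) (i : Fin R)
    (a b : Fin (R + 1) → Fin N) :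
    twoSiteOp E (R + 1) i (Nat.succ_lt_succ i.2) a b =
      E (a i.castSucc, a i.succ) (b i.castSucc, b i.succ) *
        if ∀ j, j ≠ i.castSucc → j ≠ i.succ → a j = b j then 1 else 0 := by
  have h : ∀ j : Fin (R + 1), j ∈ Finset.univ \ ({i.castSucc, i.succ} : Finset (Fin (R + 1))) ↔
      j ≠ i.castSucc ∧ j ≠ i.succ := by simp
  change E (a i.castSucc, a i.succ) (b i.castSucc, b i.succ) *
      ∏ j ∈ Finset.univ \ ({i.castSucc, i.succ} : Finset (Fin (R + 1))),
        (if a j = b j then (1 : ℂ) else 0) = _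
  congr 1
  rw [Finset.prod_ite_zero, Finset.prod_const_one]
  simp only [h, and_imp]

lemma eq_iff_sites (i : Fin R) (a b : Fin (R + 1) → Fin N) :
    a = b ↔ (a i.castSucc = b i.castSucc ∧ a i.succ = b i.succ) ∧
      ∀ j, j ≠ i.castSucc → j ≠ i.succ → a j = b j := by
  refine ⟨fun h => by simp [h], fun ⟨⟨h₁, h₂⟩, h₃⟩ => funext fun j => ?_⟩
  by_cases e₁ : j = i.castSucc
  · rw [e₁, h₁]
  by_cases e₂ : j = i.succ
  · rw [e₂, h₂]
  exact h₃ j e₁ e₂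

lemma heckeOp_eq_toMatrix (t : ℂ) (m : ℕ) (i : Fin R) :
    heckeOp t t⁻¹ m (N := N) (R + 1) i (Nat.succ_lt_succ i.2)
      = LinearMap.toMatrix' (opW t m N i) := by
  ext a b
  have h₁ := eq_iff_sites i a b
  have h₂ := eq_iff_sites i (sw i a) b
  rw [sw_castSucc, sw_succ] at h₂
  have h₃ : (∀ j, j ≠ i.castSucc → j ≠ i.succ → sw i a j = b j) ↔
      ∀ j, j ≠ i.castSucc → j ≠ i.succ → a j = b j :=
    forall_congr' fun j => imp_congr_right fun e₁ => imp_congr_right fun e₂ => by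
      rw [sw_of_ne i a e₁ e₂]
  rw [h₃] at h₂
  rw [heckeOp, twoSiteOp_apply, LinearMap.toMatrix'_apply]
  simp only [opW, lopEnd, LinearMap.coe_mk, AddHom.coe_mk, lop, h₁, h₂, Pi.single_apply]
  by_cases hP : ∀ j, j ≠ i.castSucc → j ≠ i.succ → a j = b j
  swap
  · rw [if_neg hP, if_neg (fun h => hP h.2), if_neg (fun h => hP h.2)]
    simp
  rw [if_pos hP]
  simp only [eq_true hP, and_true, Tent, coefA, coefB, eig, Prod.mk.injEq, Fin.lt_def]
  simp only [@eq_comm _ (b _) (a _)]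
  rcases lt_trichotomy (a i.castSucc) (a i.succ) with h | h | h
  · simp [h.ne, Fin.lt_def.1 h, add_comm]
  · simp [h]
  · simp [h.ne', (Fin.lt_def.1 h).not_gt]

/-- Every word is obtained from antitone words by the Hecke operators. -/
lemma word_induction {t : ℂ} {m : ℕ} (P : ((Fin (R + 1) → Fin N) → ℂ) → Prop)
    (hsmul : ∀ (c : ℂ) v, P v → P (c • v)) (hop : ∀ i v, P v → P (opW t m N i v))
    (hanti : ∀ a : Fin (R + 1) → Fin N, Antitone a → P (Pi.single a 1))
    (a : Fin (R + 1) → Fin N) : P (Pi.single a 1) := by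
  induction hn : wt (fun k => (a k : ℕ)) using Nat.strong_induction_on generalizing a with
  | _ n ih =>
  by_cases hex : ∃ j : Fin R, a j.castSucc < a j.succ
  swap
  · push Not at hex
    exact hanti a (Fin.antitone_iff_succ_le.2 hex)
  obtain ⟨i, hi⟩ := hex
  have l := wt_sw_lt (a := fun k => (a k : ℕ)) (Fin.lt_def.1 hi)
  have key : (Pi.single a 1 : (Fin (R + 1) → Fin N) → ℂ) =
      sgn ℂ m (a i.castSucc) (a i.succ) • opW t m N i (Pi.single (sw i a) 1) := by
    rw [opW, lopEnd_single, sw_sw, sw_castSucc, sw_succ]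
    · simp only [coefA, coefB, hi.not_gt, hi.ne', if_false, zero_smul, zero_add, smul_smul]
      rw [sgn_comm m (a i.succ), sgn_mul_self, one_smul]
    · intro k l
      simp only [coefB, sgn_comm m k l, eq_comm]
  rw [key]
  exact hsmul _ _ (hop _ _ (ih _ (hn ▸ l) (sw i a) rfl))

end WordMatrix

section Standard

/-- A standard tableau, recorded as the sequence of cells in the order in which they are added. -/
structure IsStd {r : ℕ} (p : Fin r → ℕ × ℕ) : Prop where
  inj : Function.Injective p
  down : ∀ j, ∀ c ≤ p j, ∃ i ≤ j, p i = c

/-- The content of a cell. -/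
def content (c : ℕ × ℕ) : ℤ := (c.2 : ℤ) - c.1

variable {r R : ℕ}

lemma IsStd.le_of_le {p : Fin r → ℕ × ℕ} (hp : IsStd p) {i j : Fin r} (h : p i ≤ p j) : i ≤ j := by
  obtain ⟨k, hk, e⟩ := hp.down j _ h
  rwa [← hp.inj e]

lemma IsStd.fst_le {p : Fin r → ℕ × ℕ} (hp : IsStd p) (j : Fin r) : (p j).1 ≤ j := by
  induction hn : (p j).1 generalizing j with
  | zero => exact Nat.zero_le _
  | succ n ih =>
    obtain ⟨i, hi, e⟩ := hp.down j (n, (p j).2) ⟨by simp [hn], le_rfl⟩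
    have h := ih i (by rw [e])
    have : i ≠ j := fun h => by rw [← h, e] at hn; simp at hn
    have := lt_of_le_of_ne hi this
    have := Fin.lt_def.1 this
    omega

lemma IsStd.snd_le {p : Fin r → ℕ × ℕ} (hp : IsStd p) (j : Fin r) : (p j).2 ≤ j := by
  induction hn : (p j).2 generalizing j with
  | zero => exact Nat.zero_le _
  | succ n ih =>
    obtain ⟨i, hi, e⟩ := hp.down j ((p j).1, n) ⟨le_rfl, by simp [hn]⟩
    have h := ih i (by rw [e])
    have : i ≠ j := fun h => by rw [← h, e] at hn; simp at hn
    have := lt_of_le_of_ne hi this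
    have := Fin.lt_def.1 this
    omega

/-- Standard tableaux with `r` cells (of arbitrary shape). -/
abbrev Tab (r : ℕ) := {p : Fin r → ℕ × ℕ // IsStd p}

instance : Finite (Tab r) := by
  have h : Set.Finite {p : Fin r → ℕ × ℕ | IsStd p} := by
    refine Set.Finite.subset (Set.Finite.pi' (t := fun _ : Fin r =>
      Set.Iic ((r, r) : ℕ × ℕ)) fun _ => Set.finite_Iic _) fun p hp j => ?_
    exact ⟨(hp.fst_le j).trans j.2.le, (hp.snd_le j).trans j.2.le⟩
  exact h.to_subtype

noncomputable instance : Fintype (Tab r) := Fintype.ofFinite _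

lemma IsStd.add_three_le {p : Fin r → ℕ × ℕ} (hp : IsStd p) {i j : Fin r} (hij : i < j)
    (h : content (p i) = content (p j)) : (i : ℕ) + 3 ≤ j := by
  have h₁ : ¬ p j ≤ p i := fun h => absurd (hp.le_of_le h) (not_le.2 hij)
  simp only [content, Prod.le_def] at h h₁
  obtain ⟨k, hk, ek⟩ := hp.down j ((p i).1 + 1, (p i).2) ⟨by simp; omega, by simp; omega⟩
  obtain ⟨l, hl, el⟩ := hp.down j ((p i).1, (p i).2 + 1) ⟨by simp; omega, by simp; omega⟩
  have a₁ : k ≠ j := fun e => by rw [e] at ek; simp [ek] at h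
  have a₂ : l ≠ j := fun e => by rw [e] at el; simp [el] at h
  have a₃ : k ≠ l := fun e => by rw [e, el] at ek; simp at ek
  have a₄ : i ≤ k := hp.le_of_le (by rw [ek]; exact ⟨by simp, le_rfl⟩)
  have a₅ : i ≤ l := hp.le_of_le (by rw [el]; exact ⟨le_rfl, by simp⟩)
  have a₆ : k ≠ i := fun e => by rw [e] at ek; simp [Prod.ext_iff] at ek
  have a₇ : l ≠ i := fun e => by rw [e] at el; simp [Prod.ext_iff] at el
  simp only [ne_eq, Fin.ext_iff, Fin.le_def] at *
  omega

/-- Two cells are adjacent when the second lies directly right of or below the first. -/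
def Adj (c d : ℕ × ℕ) : Prop := d = (c.1, c.2 + 1) ∨ d = (c.1 + 1, c.2)

lemma IsStd.adj {p : Fin (R + 1) → ℕ × ℕ} (hp : IsStd p) {i : Fin R}
    (h : p i.castSucc ≤ p i.succ) : Adj (p i.castSucc) (p i.succ) := by
  have hne : p i.castSucc ≠ p i.succ := fun e => i.castSucc_lt_succ.ne (hp.inj e)
  have key : ∀ c ≤ p i.succ, p i.castSucc ≤ c → p i.castSucc ≠ c → p i.succ = c := by
    intro c hc h₁ h₂
    obtain ⟨k, hk, ek⟩ := hp.down _ c hc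
    have h₃ : i.castSucc ≤ k := hp.le_of_le (by rw [ek]; exact h₁)
    have h₄ : i.castSucc ≠ k := fun e => h₂ (by rw [e, ek])
    rw [← ek]
    congr 1
    simp only [ne_eq, Fin.ext_iff, Fin.le_def, Fin.val_succ, Fin.val_castSucc] at *
    omega
  rw [Prod.le_def] at h
  rw [ne_eq, Prod.ext_iff] at hne
  by_cases h' : (p i.castSucc).1 < (p i.succ).1
  · exact Or.inr (key _ ⟨h', h.2⟩ ⟨by simp, le_rfl⟩ (by simp [Prod.ext_iff]))
  · exact Or.inl (key _ ⟨h.1, by simp; omega⟩ ⟨le_rfl, by simp⟩ (by simp [Prod.ext_iff]))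

lemma IsStd.not_le {p : Fin (R + 1) → ℕ × ℕ} (hp : IsStd p) (i : Fin R) :
    ¬ p i.succ ≤ p i.castSucc := fun h =>
  absurd (hp.le_of_le h) (_root_.not_le.2 i.castSucc_lt_succ)

lemma IsStd.adj_of_content {p : Fin (R + 1) → ℕ × ℕ} (hp : IsStd p) {i : Fin R}
    (h : content (p i.succ) = content (p i.castSucc) + 1 ∨
      content (p i.succ) = content (p i.castSucc) - 1) : Adj (p i.castSucc) (p i.succ) := by
  apply hp.adj
  have h₁ := hp.not_le i
  simp only [content, Prod.le_def] at *
  omega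

lemma Adj.content {c d : ℕ × ℕ} (h : Adj c d) :
    content d = content c + 1 ∨ content d = content c - 1 := by
  rcases h with rfl | rfl <;> simp [HookSchurWeyl.content] <;> omega

lemma IsStd.sw {p : Fin (R + 1) → ℕ × ℕ} (hp : IsStd p) {i : Fin R}
    (h : ¬ p i.castSucc ≤ p i.succ) : IsStd (sw i p) where
  inj := hp.inj.comp (Equiv.injective _)
  down j c hc := by
    have key : ∀ k, p k = c → (Equiv.swap i.castSucc i.succ k ≤ j) →
        ∃ i_1 ≤ j, HookSchurWeyl.sw i p i_1 = c := fun k hk hj =>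
      ⟨_, hj, by simp [HookSchurWeyl.sw, hk]⟩
    by_cases h₁ : j = i.castSucc
    · subst h₁
      rw [sw_castSucc] at hc
      obtain ⟨k, hk, e⟩ := hp.down _ c hc
      apply key k e
      by_cases h₂ : k = i.succ
      · simp [h₂]
      by_cases h₃ : k = i.castSucc
      · rw [← e, h₃] at hc; exact absurd hc h
      rw [Equiv.swap_apply_of_ne_of_ne h₃ h₂]
      simp only [Fin.ext_iff, Fin.le_def, Fin.val_succ, Fin.val_castSucc] at *
      omega
    by_cases h₂ : j = i.succ
    · subst h₂
      rw [sw_succ] at hc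
      obtain ⟨k, hk, e⟩ := hp.down _ c hc
      apply key k e
      by_cases h₃ : k = i.castSucc
      · simp [h₃]
      have h₄ : k ≠ i.succ := fun e => by simp [e, Fin.le_def] at hk
      rw [Equiv.swap_apply_of_ne_of_ne h₃ h₄]
      exact hk.trans i.castSucc_lt_succ.le
    · rw [sw_of_ne i p h₁ h₂] at hc
      obtain ⟨k, hk, e⟩ := hp.down _ c hc
      apply key k e
      by_cases h₃ : k = i.castSucc
      · rw [h₃, Equiv.swap_apply_left]
        simp only [Fin.ext_iff, Fin.le_def, Fin.val_succ, Fin.val_castSucc] at *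
        omega
      by_cases h₄ : k = i.succ
      · rw [h₄, Equiv.swap_apply_right]
        simp only [Fin.ext_iff, Fin.le_def, Fin.val_succ, Fin.val_castSucc] at *
        omega
      rwa [Equiv.swap_apply_of_ne_of_ne h₃ h₄]

/-- A standard tableau is determined by its sequence of contents. -/
lemma IsStd.ext_content {p p' : Fin r → ℕ × ℕ} (hp : IsStd p) (hp' : IsStd p')
    (h : ∀ j, content (p j) = content (p' j)) : p = p' := by
  funext j
  induction j using WellFoundedLT.induction with
  | _ j ih =>
  have key : ∀ {p p' : Fin r → ℕ × ℕ}, IsStd p → IsStd p' → (∀ i < j, p i = p' i) →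
      p j ≤ p' j → p j = p' j := by
    intro p p' hp hp' ih hle
    obtain ⟨i, hi, e⟩ := hp'.down j _ hle
    rcases hi.lt_or_eq with hi | hi
    · rw [← ih i hi] at e
      exact absurd (hp.inj e) hi.ne
    · rw [← e, hi]
  have h₁ := h j
  rcases le_total (p j).1 (p' j).1 with h₂ | h₂
  · exact key hp hp' ih ⟨h₂, by simp only [content] at h₁; omega⟩
  · exact (key hp' hp (fun i hi => (ih i hi).symm) ⟨h₂, by simp only [content] at h₁; omega⟩).symm

end Standard

section TableauOperators

variable {R : ℕ}

/-- The eigenvalue `t ^ (2 · content)` of a Jucys–Murphy element attached to a cell. -/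
noncomputable def jm (t : ℂ) (c : ℕ × ℕ) : ℂ := t ^ (2 * content c)

/-- A parameter that is neither zero nor a root of unity. -/
structure Generic (t : ℂ) : Prop where
  ne_zero : t ≠ 0
  pow_ne_one : ∀ k : ℕ, 0 < k → t ^ k ≠ 1

/-- The diagonal coefficient in Young's seminormal form. -/
noncomputable def tabA (t : ℂ) (c d : ℕ × ℕ) : ℂ := (t - t⁻¹) * jm t d / (jm t d - jm t c)

/-- The off-diagonal coefficient in Young's seminormal form. -/
noncomputable def tabB (t : ℂ) (c d : ℕ × ℕ) : ℂ :=
  if content d = content c + 1 ∨ content d = content c - 1 then 0 else t - tabA t c d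

variable {t : ℂ}

lemma jm_ne_zero (ht : Generic t) (c : ℕ × ℕ) : jm t c ≠ 0 := zpow_ne_zero _ ht.ne_zero

lemma Generic.zpow_ne_one (ht : Generic t) {k : ℤ} (hk : k ≠ 0) : t ^ k ≠ 1 := by
  rcases Int.natAbs_eq k with h | h
  · rw [h, zpow_natCast]; exact ht.pow_ne_one _ (by omega)
  · rw [h, zpow_neg, zpow_natCast, ne_eq, inv_eq_one]; exact ht.pow_ne_one _ (by omega)

lemma jm_inj (ht : Generic t) {c d : ℕ × ℕ} : jm t c = jm t d ↔ content c = content d := by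
  refine ⟨fun h => ?_, fun h => by rw [jm, jm, h]⟩
  by_contra hne
  refine ht.zpow_ne_one (k := 2 * content c - 2 * content d) (by omega) ?_
  rw [zpow_sub₀ ht.ne_zero]
  exact div_eq_one_iff_eq (zpow_ne_zero _ ht.ne_zero) |>.2 h

lemma tabA_row (ht : Generic t) {c d : ℕ × ℕ} (h : content d = content c + 1) :
    tabA t c d = t := by
  have h₀ := ht.ne_zero
  have h₁ : jm t d = t ^ 2 * jm t c := by
    rw [jm, jm, h, mul_add, zpow_add₀ h₀, mul_comm]; norm_cast
  have h₂ := jm_ne_zero ht c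
  have h₃ : t ^ 2 - 1 ≠ 0 := sub_ne_zero.2 (ht.pow_ne_one 2 (by simp))
  have h₄ : t ^ 2 * jm t c - jm t c ≠ 0 := by
    rw [show t ^ 2 * jm t c - jm t c = (t ^ 2 - 1) * jm t c by ring]; exact mul_ne_zero h₃ h₂
  rw [tabA, h₁, div_eq_iff h₄]
  field_simp

lemma tabA_add (ht : Generic t) {c d : ℕ × ℕ} (h : content c ≠ content d) :
    tabA t c d + tabA t d c = t - t⁻¹ := by
  have h₁ : jm t c ≠ jm t d := fun e => h ((jm_inj ht).1 e)
  have h₂ := sub_ne_zero.2 h₁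
  have h₃ := sub_ne_zero.2 h₁.symm
  unfold tabA
  rw [div_add_div _ _ h₃ h₂, div_eq_iff (mul_ne_zero h₃ h₂)]
  ring

lemma tabA_col (ht : Generic t) {c d : ℕ × ℕ} (h : content d = content c - 1) :
    tabA t c d = -t⁻¹ := by
  have h₁ := tabA_add ht (c := c) (d := d) (by omega)
  rw [tabA_row ht (c := d) (d := c) (by omega)] at h₁
  linear_combination h₁

lemma tabA_triple (ht : Generic t) {x y w : ℕ × ℕ} (h₁ : content x ≠ content y)
    (h₂ : content y ≠ content w) (h₃ : content x ≠ content w) :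
    tabA t x w * tabA t y x + tabA t x y * tabA t y w = tabA t y w * tabA t x w := by
  have a₁ := sub_ne_zero.2 fun e => h₁ ((jm_inj ht).1 e)
  have a₂ := sub_ne_zero.2 fun e => h₁.symm ((jm_inj ht).1 e)
  have b₁ := sub_ne_zero.2 fun e => h₂ ((jm_inj ht).1 e)
  have b₂ := sub_ne_zero.2 fun e => h₂.symm ((jm_inj ht).1 e)
  have c₁ := sub_ne_zero.2 fun e => h₃ ((jm_inj ht).1 e)
  have c₂ := sub_ne_zero.2 fun e => h₃.symm ((jm_inj ht).1 e)
  unfold tabA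
  generalize t - t⁻¹ = z
  generalize jm t x = X at *
  generalize jm t y = Y at *
  generalize jm t w = W at *
  rw [← neg_sub Y X, div_neg]
  field_simp
  ring

lemma tabB_mul (ht : Generic t) {c d : ℕ × ℕ} (h : content c ≠ content d) :
    tabB t c d * tabB t d c = 1 + tabA t c d * tabA t d c := by
  have h₀ := ht.ne_zero
  unfold tabB
  by_cases h₁ : content d = content c + 1
  · rw [if_pos (Or.inl h₁), tabA_row ht h₁, tabA_col ht (c := d) (d := c) (by omega)]
    field_simp; ring
  by_cases h₂ : content d = content c - 1
  · rw [if_pos (Or.inr h₂), tabA_col ht h₂, tabA_row ht (c := d) (d := c) (by omega)]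
    field_simp; ring
  rw [if_neg (by omega), if_neg (by omega)]
  have := tabA_add ht h
  field_simp at this ⊢
  linear_combination -this

lemma tabB_ne_zero (ht : Generic t) {c d : ℕ × ℕ} (h : content c ≠ content d)
    (h₁ : ¬ (content d = content c + 1 ∨ content d = content c - 1)) : tabB t c d ≠ 0 := by
  have h₀ := ht.ne_zero
  rw [tabB, if_neg h₁]
  have h₁' : jm t c ≠ jm t d := fun e => h ((jm_inj ht).1 e)
  have h₃ := sub_ne_zero.2 h₁'.symm
  intro h₂
  rw [sub_eq_zero, tabA, eq_div_iff h₃] at h₂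
  have h₄ : jm t d = t ^ 2 * jm t c := by
    field_simp at h₂
    linear_combination h₂
  have h₅ : t ^ 2 * jm t c = t ^ (2 * (content c + 1)) := by
    rw [mul_add, zpow_add₀ h₀, mul_comm, jm]; norm_cast
  rw [h₅] at h₄
  refine ht.zpow_ne_one (k := 2 * content d - 2 * (content c + 1)) (by omega) ?_
  rw [zpow_sub₀ h₀]
  exact div_eq_one_iff_eq (zpow_ne_zero _ h₀) |>.2 h₄

/-- Extension by zero of a function on tableaux. -/
noncomputable def zext {r : ℕ} (f : Tab r → ℂ) (a : Fin r → ℕ × ℕ) : ℂ :=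
  open Classical in if h : IsStd a then f ⟨a, h⟩ else 0

@[simp] lemma zext_coe {r : ℕ} (f : Tab r → ℂ) (p : Tab r) : zext f p.1 = f p := by
  rw [zext, dif_pos p.2]

lemma zext_of_not {r : ℕ} (f : Tab r → ℂ) {a : Fin r → ℕ × ℕ} (h : ¬ IsStd a) : zext f a = 0 := by
  rw [zext, dif_neg h]

/-- Young's seminormal operators on functions on standard tableaux. -/
noncomputable def opV (t : ℂ) (i : Fin R) : Module.End ℂ (Tab (R + 1) → ℂ) where
  toFun f p := lop (tabA t) (tabB t) i (zext f) p.1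
  map_add' f g := by
    have : ∀ a, zext (f + g) a = zext f a + zext g a := fun a => by
      by_cases h : IsStd a <;> simp [zext, h]
    funext p; simp only [lop, this, Pi.add_apply]; ring
  map_smul' c f := by
    have : ∀ a, zext (c • f) a = c * zext f a := fun a => by
      by_cases h : IsStd a <;> simp [zext, h]
    funext p; simp only [lop, this, Pi.smul_apply, smul_eq_mul, RingHom.id_apply]; ring

lemma opV_apply (i : Fin R) (f : Tab (R + 1) → ℂ) (p : Tab (R + 1)) :
    opV t i f p = tabA t (p.1 i.castSucc) (p.1 i.succ) * f p
      + tabB t (p.1 i.castSucc) (p.1 i.succ) * zext f (sw i p.1) := by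
  rw [← zext_coe f]; rfl

lemma IsStd.sw_of_not {p : Fin (R + 1) → ℕ × ℕ} (hp : IsStd p) {i : Fin R}
    (h : ¬ (content (p i.succ) = content (p i.castSucc) + 1 ∨
      content (p i.succ) = content (p i.castSucc) - 1)) : IsStd (HookSchurWeyl.sw i p) :=
  hp.sw fun h' => h (hp.adj h').content

lemma zext_opV (i : Fin R) (f : Tab (R + 1) → ℂ) :
    zext (opV t i f) = lop (tabA t) (tabB t) i (zext f) := by
  funext a
  by_cases h : IsStd a
  · exact zext_coe (opV t i f) ⟨a, h⟩
  rw [zext_of_not _ h, lop, zext_of_not _ h, mul_zero, zero_add]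
  by_cases h' : IsStd (sw i a)
  · rw [tabB, if_pos, zero_mul]
    by_contra h''
    refine h ?_
    have := h'.sw_of_not (i := i) (by rw [sw_castSucc, sw_succ]; omega)
    rwa [sw_sw] at this
  · rw [zext_of_not _ h', mul_zero]

lemma IsStd.content_ne {p : Fin (R + 1) → ℕ × ℕ} (hp : IsStd p) (i : Fin R) :
    content (p i.castSucc) ≠ content (p i.succ) := fun h => by
  have := hp.add_three_le i.castSucc_lt_succ h
  simp at this

lemma opV_heckeRel (ht : Generic t) : HeckeRel (t - t⁻¹) (opV (R := R) t) where
  quad i := by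
    refine LinearMap.ext fun f => funext fun p => ?_
    change lop _ _ i (zext (opV t i f)) p.1 = (t - t⁻¹) * lop _ _ i (zext f) p.1 + f p
    have h := p.2.content_ne i
    have h₁ := tabA_add ht h
    rw [zext_opV, lop_quad (z := t - t⁻¹), zext_coe]
    · rw [tabB_mul ht h]; linear_combination tabA t (p.1 i.castSucc) (p.1 i.succ) * h₁
    · rw [h₁]; ring
  comm i j h := by
    refine LinearMap.ext fun f => funext fun p => ?_
    change lop _ _ i (zext (opV t j f)) p.1 = lop _ _ j (zext (opV t i f)) p.1
    rw [zext_opV, zext_opV, lop_comm h]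
  braid i j h := by
    refine LinearMap.ext fun f => funext fun p => ?_
    change lop _ _ i (zext (opV t j (opV t i f))) p.1 = lop _ _ j (zext (opV t i (opV t j f))) p.1
    rw [zext_opV, zext_opV, zext_opV, zext_opV]
    have e := castSucc_eq_succ h
    have h₁ := p.2.content_ne i
    have h₂ := p.2.content_ne j
    have h₃ : content (p.1 i.castSucc) ≠ content (p.1 j.succ) := fun h' => by
      have := p.2.add_three_le (i := i.castSucc) (j := j.succ)
        (by simp only [Fin.lt_def, Fin.val_castSucc, Fin.val_succ]; omega) h'
      simp only [Fin.val_castSucc, Fin.val_succ] at this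
      omega
    rw [e] at h₂
    have t₁ := tabA_triple ht h₁ h₂ h₃
    have s₁ := tabA_add ht h₁
    have s₂ := tabA_add ht h₂
    have b₁ := tabB_mul ht h₁
    have b₂ := tabB_mul ht h₂
    refine lop_braid h _ _ rfl rfl rfl ?_ ?_ ?_
    · linear_combination tabA t (p.1 i.castSucc) (p.1 j.succ) * b₁
        - tabA t (p.1 i.castSucc) (p.1 j.succ) * b₂
        + (tabA t (p.1 i.castSucc) (p.1 i.succ) - tabA t (p.1 i.succ) (p.1 j.succ)) * t₁
        + tabA t (p.1 i.castSucc) (p.1 j.succ) * tabA t (p.1 i.succ) (p.1 j.succ) * (s₁ - s₂)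
    · linear_combination tabB t (p.1 i.castSucc) (p.1 i.succ) * t₁
    · linear_combination tabB t (p.1 i.succ) (p.1 j.succ) * (t₁
        + tabA t (p.1 i.castSucc) (p.1 j.succ) * s₂ - tabA t (p.1 i.castSucc) (p.1 j.succ) * s₁)

end TableauOperators

section Sorting

variable {R : ℕ}

/-- The set of cells of a tableau. -/
def shape {r : ℕ} (p : Tab r) : Finset (ℕ × ℕ) := Finset.univ.image p.1

lemma mem_shape {r : ℕ} {p : Tab r} {c : ℕ × ℕ} : c ∈ shape p ↔ ∃ j, p.1 j = c := by
  simp [shape]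

lemma shape_sw {p q : Tab (R + 1)} {i : Fin R} (h : q.1 = sw i p.1) : shape q = shape p := by
  ext c
  rw [mem_shape, mem_shape, h]
  exact (Equiv.swap i.castSucc i.succ).surjective.exists (p := fun j => p.1 j = c) |>.symm

lemma mul_add_inj {r a b c d : ℕ} (hb : b < r) (hd : d < r) (h : a * r + b = c * r + d) :
    a = c ∧ b = d := by
  have hr : 0 < r := by omega
  have h₁ := congrArg (· / r) h
  have h₂ := congrArg (· % r) h
  simp only [Nat.mul_comm _ r, Nat.mul_add_div hr, Nat.div_eq_of_lt hb, Nat.div_eq_of_lt hd,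
    Nat.mul_add_mod, Nat.mod_eq_of_lt hb, Nat.mod_eq_of_lt hd, add_zero] at h₁ h₂
  exact ⟨h₁, h₂⟩

/-- A nonempty family of tableaux closed under certain exchanges contains a member which is
sorted along those exchanges, with respect to given monotone keys. -/
lemma exists_sorted {B : Fin R → Prop} {P : Tab (R + 1) → Prop} {κ : Fin (R + 1) → ℕ × ℕ → ℕ}
    (hκ : ∀ k, Monotone (κ k)) (hB : ∀ i, B i → κ i.castSucc = κ i.succ)
    (hP : ∀ i, B i → ∀ p q : Tab (R + 1), q.1 = sw i p.1 → P p → P q) (h : ∃ p, P p) :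
    ∃ p, P p ∧ ∀ i, B i → κ i.castSucc (p.1 i.castSucc) ≤ κ i.succ (p.1 i.succ) := by
  obtain ⟨p, hp, hmax⟩ := Set.exists_max_image {p | P p} (fun p => wt fun k => κ k (p.1 k))
    (Set.toFinite _) h
  refine ⟨p, hp, fun i hi => ?_⟩
  by_contra hlt
  have hstd : IsStd (sw i p.1) := p.2.sw fun h' => hlt (by rw [hB i hi]; exact hκ _ h')
  refine absurd (hmax ⟨_, hstd⟩ (hP i hi p _ rfl hp)) (not_le.2 ?_)
  have e : (fun k => κ k (p.1 k)) = sw i fun k => κ k (sw i p.1 k) := by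
    funext k
    by_cases h₁ : k = i.castSucc
    · rw [h₁, sw_castSucc, sw_succ, hB i hi]
    by_cases h₂ : k = i.succ
    · rw [h₂, sw_succ, sw_castSucc, hB i hi]
    rw [sw_of_ne i _ h₁ h₂, sw_of_ne i _ h₁ h₂]
  simp only [e]
  apply wt_sw_lt
  rw [sw_castSucc, sw_succ, hB i hi, ← hB i hi]
  rw [not_le] at hlt
  rwa [hB i hi, ← hB i hi] at hlt

/-- Tableaux of the same shape are connected by exchanges. -/
lemma connected {P : Tab (R + 1) → Prop}
    (hP : ∀ i, ∀ p q : Tab (R + 1), q.1 = sw i p.1 → P p → P q) {p p' : Tab (R + 1)}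
    (h : shape p = shape p') (hp : P p) : P p' := by
  let κ : ℕ × ℕ → ℕ := fun c => c.1 * (R + 1) + c.2
  have hκ : Monotone κ := fun c d h => add_le_add (Nat.mul_le_mul_right _ h.1) h.2
  have hinj : ∀ (q : Tab (R + 1)) (i j : Fin (R + 1)), κ (q.1 i) = κ (q.1 j) → i = j := by
    intro q i j hij
    have h₁ := (q.2.snd_le i).trans_lt i.2
    have h₂ := (q.2.snd_le j).trans_lt j.2
    apply q.2.inj
    exact Prod.ext_iff.2 (mul_add_inj h₁ h₂ hij)
  have hmono : ∀ q : Tab (R + 1), (∀ i : Fin R, κ (q.1 i.castSucc) ≤ κ (q.1 i.succ)) →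
      StrictMono fun j => κ (q.1 j) := fun q hq => Fin.strictMono_iff_lt_succ.2 fun i =>
    lt_of_le_of_ne (hq i) fun e => i.castSucc_lt_succ.ne (hinj q _ _ e)
  have key : ∀ q₀ : Tab (R + 1), ∃ q, (shape q = shape q₀ ∧ (P q ↔ P q₀)) ∧
      ∀ i : Fin R, True → κ (q.1 i.castSucc) ≤ κ (q.1 i.succ) := fun q₀ =>
    exists_sorted (κ := fun _ => κ) (fun _ => hκ) (fun _ _ => rfl)
      (fun i _ p q hpq ⟨h₁, h₂⟩ => ⟨(shape_sw hpq).trans h₁,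
        Iff.trans ⟨hP i q p (by rw [hpq, sw_sw]), hP i p q hpq⟩ h₂⟩) ⟨q₀, rfl, Iff.rfl⟩
  obtain ⟨q, ⟨h₁, h₂⟩, h₃⟩ := key p
  obtain ⟨q', ⟨h₁', h₂'⟩, h₃'⟩ := key p'
  have hrange : (fun j => κ (q.1 j)) = fun j => κ (q'.1 j) := by
    rw [← (hmono q fun i => h₃ i trivial).range_inj (hmono q' fun i => h₃' i trivial)]
    have hs : ∀ q : Tab (R + 1), (Set.range fun j => κ (q.1 j)) = κ '' (shape q : Set (ℕ × ℕ)) := by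
      intro q
      simp only [shape, Finset.coe_image, Finset.coe_univ, Set.image_univ, ← Set.range_comp]
      rfl
    rw [hs, hs, h₁, h₁', h]
  have : q = q' := by
    refine Subtype.ext (funext fun j => ?_)
    have hj := congrFun hrange j
    have h₁ := (q.2.snd_le j).trans_lt j.2
    have h₂ := (q'.2.snd_le j).trans_lt j.2
    exact Prod.ext_iff.2 (mul_add_inj h₁ h₂ hj)
  exact h₂'.1 (this ▸ h₂.2 hp)

end Sorting

section MatrixUnits

variable {R : ℕ} {t : ℂ}

/-- Multiplication by a function. -/
def diagEnd (ι : Type*) : (ι → ℂ) →ₐ[ℂ] Module.End ℂ (ι → ℂ) := Algebra.lmul ℂ (ι → ℂ)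

@[simp] lemma diagEnd_apply {ι : Type*} (g f : ι → ℂ) : diagEnd ι g f = g * f := rfl

/-- A point-separating algebra of functions on a finite set contains all indicators. -/
lemma single_mem_of_separates {ι : Type*} [Fintype ι] [DecidableEq ι] (S : Subalgebra ℂ (ι → ℂ))
    (h : ∀ x y, x ≠ y → ∃ g ∈ S, g x ≠ g y) (x : ι) : Pi.single x 1 ∈ S := by
  have h' : ∀ y, ∃ g ∈ S, g x = 1 ∧ (y ≠ x → g y = 0) := by
    intro y
    by_cases hy : y = x
    · exact ⟨1, one_mem _, rfl, fun h => absurd hy h⟩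
    obtain ⟨g, hg, hne⟩ := h x y (Ne.symm hy)
    refine ⟨(g x - g y)⁻¹ • (g - algebraMap ℂ _ (g y)),
      S.smul_mem (S.sub_mem hg (S.algebraMap_mem _)) _, ?_, fun _ => ?_⟩
    · simp [sub_ne_zero.2 hne]
    · simp
  choose g hg h₁ h₀ using h'
  have : (Pi.single x 1 : ι → ℂ) = ∏ y, g y := by
    funext z
    rw [Finset.prod_apply]
    by_cases hz : z = x
    · subst hz; simp [h₁]
    · rw [Pi.single_eq_of_ne hz]
      exact (Finset.prod_eq_zero (f := fun y => g y z) (Finset.mem_univ z) (h₀ z hz)).symm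
  rw [this]
  exact S.prod_mem fun y _ => hg y

/-- The seminormal representation of the free algebra. -/
noncomputable def repV (t : ℂ) (R : ℕ) :
    FreeAlgebra ℂ (Fin R) →ₐ[ℂ] Module.End ℂ (Tab (R + 1) → ℂ) := FreeAlgebra.lift ℂ (opV t)

@[simp] lemma repV_ι (i : Fin R) : repV t R (FreeAlgebra.ι ℂ i) = opV t i := by simp [repV]

/-- The Jucys–Murphy elements act diagonally. -/
lemma opV_diag_opV (ht : Generic t) (i : Fin R) :
    opV t i * diagEnd _ (fun p => jm t (p.1 i.castSucc)) * opV t i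
      = diagEnd _ fun p => jm t (p.1 i.succ) := by
  refine LinearMap.ext fun f => funext fun p => ?_
  have hne := p.2.content_ne i
  set c := p.1 i.castSucc with hc
  set d := p.1 i.succ with hd
  have hx : jm t c ≠ jm t d := fun e => hne ((jm_inj ht).1 e)
  have h₁ := sub_ne_zero.2 hx
  have h₂ := sub_ne_zero.2 hx.symm
  have hA : tabA t c d * jm t c + tabA t d c * jm t d = 0 := by
    unfold tabA
    rw [← neg_sub (jm t c), div_neg]
    field_simp
    ring
  have hB := tabB_mul ht hne
  set g : Tab (R + 1) → ℂ := diagEnd _ (fun p => jm t (p.1 i.castSucc)) (opV t i f) with hg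
  change opV t i g p = jm t d * f p
  have hgp : g p = jm t c * (tabA t c d * f p + tabB t c d * zext f (sw i p.1)) := by
    rw [hg, diagEnd_apply, Pi.mul_apply, opV_apply]
  rw [opV_apply, hgp, ← hc, ← hd]
  by_cases hs : IsStd (sw i p.1)
  · have hgq := zext_coe g ⟨_, hs⟩
    have hfq := zext_coe f ⟨_, hs⟩
    have h₃ : g ⟨_, hs⟩ = jm t d * (tabA t d c * zext f (sw i p.1) + tabB t d c * f p) := by
      rw [hg, diagEnd_apply, Pi.mul_apply, opV_apply]
      simp only [sw_castSucc, sw_succ, sw_sw, zext_coe, ← hc, ← hd]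
      rw [← hfq]
    dsimp only at hgq
    rw [hgq, h₃]
    linear_combination (f p * tabA t c d + zext f (sw i p.1) * tabB t c d) * hA
      + f p * jm t d * hB
  · have h₀ : tabB t c d = 0 := by
      rw [tabB, if_pos]
      by_contra h
      exact hs (p.2.sw_of_not h)
    rw [h₀] at hB ⊢
    linear_combination (f p * tabA t c d) * hA + f p * jm t d * hB

lemma diag_jm_mem (ht : Generic t) (k : Fin (R + 1)) :
    diagEnd _ (fun p : Tab (R + 1) => jm t (p.1 k)) ∈ (repV t R).range := by
  induction k using Fin.induction with
  | zero =>
    have : (fun p : Tab (R + 1) => jm t (p.1 0)) = 1 := by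
      funext p
      have h₁ := p.2.fst_le 0
      have h₂ := p.2.snd_le 0
      simp only [Fin.val_zero, Nat.le_zero] at h₁ h₂
      simp [jm, content, h₁, h₂]
    rw [this, map_one]
    exact one_mem _
  | succ i ih =>
    rw [← opV_diag_opV ht]
    have : opV t i ∈ (repV t R).range := ⟨FreeAlgebra.ι ℂ i, repV_ι i⟩
    exact mul_mem (mul_mem this ih) this

/-- The matrix unit which sends the indicator of `q` to that of `p`. -/
noncomputable def unitV {r : ℕ} (p q : Tab r) : Module.End ℂ (Tab r → ℂ) :=
  open Classical in LinearMap.single ℂ (fun _ => ℂ) p ∘ₗ LinearMap.proj q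

open Classical in
lemma unitV_apply {r : ℕ} (p q : Tab r) (f : Tab r → ℂ) : unitV p q f = Pi.single p (f q) := rfl

lemma unitV_self_mem (ht : Generic t) (p : Tab (R + 1)) : unitV p p ∈ (repV t R).range := by
  classical
  have h := single_mem_of_separates ((repV t R).range.comap (diagEnd (Tab (R + 1)))) (by
    intro p q hpq
    by_contra! hall
    refine hpq (Subtype.ext (p.2.ext_content q.2 fun j => (jm_inj ht).1 ?_))
    exact hall (fun p => jm t (p.1 j)) (diag_jm_mem ht j)) p
  rw [Subalgebra.mem_comap] at h
  convert h using 1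
  refine LinearMap.ext fun f => ?_
  rw [unitV_apply, diagEnd_apply]
  funext q
  by_cases hq : q = p
  · subst hq; simp
  · simp [hq]

lemma IsStd.content_of_sw {p : Fin (R + 1) → ℕ × ℕ} (hp : IsStd p) {i : Fin R}
    (h : IsStd (HookSchurWeyl.sw i p)) : ¬ (content (p i.succ) = content (p i.castSucc) + 1 ∨
      content (p i.succ) = content (p i.castSucc) - 1) := by
  intro h'
  have h₁ := h.not_le i
  rw [sw_castSucc, sw_succ] at h₁
  refine h₁ ?_
  rcases hp.adj_of_content h' with e | e <;> rw [e] <;> simp [Prod.le_def]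

lemma unitV_mem (ht : Generic t) {p q : Tab (R + 1)} (h : shape p = shape q) :
    unitV p q ∈ (repV t R).range := by
  classical
  refine connected (P := fun p => unitV p q ∈ (repV t R).range) ?_ h.symm (unitV_self_mem ht q)
  intro i p p' hp' hp
  have hmem : unitV p' p' * opV t i * unitV p q ∈ (repV t R).range :=
    mul_mem (mul_mem (unitV_self_mem ht p') ⟨FreeAlgebra.ι ℂ i, repV_ι i⟩) hp
  have hc := p'.2.content_of_sw (i := i) (by rw [hp', sw_sw]; exact p.2)
  have hB := tabB_ne_zero ht (p'.2.content_ne i) hc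
  have hpp : p ≠ p' := by
    intro e
    have := congrFun hp' i.castSucc
    rw [sw_castSucc, e] at this
    exact i.castSucc_lt_succ.ne (p'.2.inj this)
  have e : unitV p' p' * opV t i * unitV p q
      = tabB t (p'.1 i.castSucc) (p'.1 i.succ) • unitV p' q := by
    refine LinearMap.ext fun f => ?_
    have hs : sw i p'.1 = p.1 := by rw [hp', sw_sw]
    rw [Module.End.mul_apply, Module.End.mul_apply, LinearMap.smul_apply, unitV_apply,
      unitV_apply, unitV_apply, opV_apply, hs, zext_coe, Pi.single_eq_same,
      Pi.single_eq_of_ne hpp.symm, mul_zero, zero_add, ← Pi.single_smul, smul_eq_mul]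
  rw [e] at hmem
  have := (repV t R).range.smul_mem hmem (tabB t (p'.1 i.castSucc) (p'.1 i.succ))⁻¹
  rwa [smul_smul, inv_mul_cancel₀ hB, one_smul] at this

lemma repV_local (x : FreeAlgebra ℂ (Fin R)) {f : Tab (R + 1) → ℂ} {p : Tab (R + 1)}
    (hf : ∀ q, shape q = shape p → f q = 0) : repV t R x f p = 0 := by
  suffices h : ∀ f : Tab (R + 1) → ℂ, (∀ q, shape q = shape p → f q = 0) →
      ∀ q, shape q = shape p → repV t R x f q = 0 from h f hf p rfl
  clear hf f
  induction x using FreeAlgebra.induction with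
  | grade0 c => intro f hf q hq; simp [hf q hq]
  | grade1 i =>
    intro f hf q hq
    rw [repV_ι, opV_apply, hf q hq, mul_zero, zero_add]
    by_cases hs : IsStd (sw i q.1)
    · have := zext_coe f ⟨_, hs⟩
      dsimp only at this
      rw [this, hf _ ((shape_sw (p := q) (q := ⟨_, hs⟩) rfl).trans hq), mul_zero]
    · rw [zext_of_not _ hs, mul_zero]
  | add x y hx hy =>
    intro f hf q hq
    rw [map_add, LinearMap.add_apply, Pi.add_apply, hx f hf q hq, hy f hf q hq, add_zero]
  | mul x y hx hy =>
    intro f hf q hq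
    rw [map_mul, Module.End.mul_apply, hx _ (hy f hf) q hq]

/-- The elements acting as zero on the tableaux whose shapes satisfy `H`. -/
def vanish (t : ℂ) (R : ℕ) (H : Finset (ℕ × ℕ) → Prop) : Submodule ℂ (FreeAlgebra ℂ (Fin R)) where
  carrier := {x | ∀ f p, H (shape p) → repV t R x f p = 0}
  zero_mem' := by simp
  add_mem' hx hy f p hp := by simp [hx f p hp, hy f p hp]
  smul_mem' c x hx f p hp := by simp [hx f p hp]

open Classical in
lemma mem_vanish {H : Finset (ℕ × ℕ) → Prop} {x : FreeAlgebra ℂ (Fin R)} :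
    x ∈ vanish t R H ↔ ∀ p q : Tab (R + 1), shape p = shape q → H (shape p) →
      repV t R x (Pi.single q 1) p = 0 := by
  refine ⟨fun h p q _ hp => h _ p hp, fun h f p hp => ?_⟩
  have hf : f = ∑ q, f q • (Pi.single q 1 : Tab (R + 1) → ℂ) := by
    funext s; simp [Finset.sum_apply, Pi.single_apply]
  rw [hf, map_sum, Finset.sum_apply]
  refine Finset.sum_eq_zero fun q _ => ?_
  rw [map_smul, Pi.smul_apply]
  by_cases hq : shape p = shape q
  · rw [h p q hq hp, smul_zero]
  · rw [repV_local, smul_zero]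
    intro s hs
    exact Pi.single_eq_of_ne (fun e => hq (by rw [← hs, e])) 1

/-- Pairs of tableaux of the same shape satisfying `H`. -/
abbrev TabPair (r : ℕ) (H : Finset (ℕ × ℕ) → Prop) :=
  {pq : Tab r × Tab r // shape pq.1 = shape pq.2 ∧ H (shape pq.1)}

lemma finrank_quotient_vanish (ht : Generic t) (H : Finset (ℕ × ℕ) → Prop) :
    Module.finrank ℂ (FreeAlgebra ℂ (Fin R) ⧸ vanish t R H) = Nat.card (TabPair (R + 1) H) := by
  classical
  let ψ : FreeAlgebra ℂ (Fin R) →ₗ[ℂ] (TabPair (R + 1) H → ℂ) :=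
    LinearMap.pi fun pq => LinearMap.proj pq.1.1 ∘ₗ LinearMap.applyₗ (Pi.single pq.1.2 1) ∘ₗ
      (repV t R).toLinearMap
  have hψ : ∀ x pq, ψ x pq = repV t R x (Pi.single pq.1.2 1) pq.1.1 := fun x pq => rfl
  have hker : LinearMap.ker ψ = vanish t R H := by
    ext x
    rw [LinearMap.mem_ker, mem_vanish]
    exact ⟨fun h p q hpq hp => congrFun h ⟨(p, q), hpq, hp⟩,
      fun h => funext fun pq => h _ _ pq.2.1 pq.2.2⟩
  have hsurj : LinearMap.range ψ = ⊤ := by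
    rw [eq_top_iff, ← (Pi.basisFun ℂ _).span_eq, Submodule.span_le]
    rintro _ ⟨pq, rfl⟩
    obtain ⟨x, hx⟩ := unitV_mem ht pq.2.1
    refine ⟨x, funext fun pq' => ?_⟩
    change repV t R x = _ at hx
    rw [hψ, hx, unitV_apply, Pi.basisFun_apply, Pi.single_apply, Pi.single_apply, Pi.single_apply]
    have : pq' = pq ↔ pq'.1.1 = pq.1.1 ∧ pq.1.2 = pq'.1.2 := by
      rw [Subtype.ext_iff, Prod.ext_iff, @eq_comm _ pq.1.2]
    simp only [this, ite_and]
  rw [← hker, (LinearMap.quotKerEquivRange ψ).finrank_eq, hsurj, finrank_top,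
    Module.finrank_fintype_fun_eq_card, Nat.card_eq_fintype_card]

end MatrixUnits

section Branching

/-- A finite set of cells closed under passing to smaller cells. -/
def IsLow (S : Finset (ℕ × ℕ)) : Prop := ∀ c ∈ S, ∀ d ≤ c, d ∈ S

/-- The cells that may be added to `S`. -/
noncomputable def addCells (S : Finset (ℕ × ℕ)) : Finset (ℕ × ℕ) :=
  @Finset.filter _ (fun c => c ∉ S ∧ ∀ d ≤ c, d ≠ c → d ∈ S) (Classical.decPred _)
    (insert (0, 0) (S.image (fun c => (c.1 + 1, c.2)) ∪ S.image fun c => (c.1, c.2 + 1)))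

open Classical in
/-- The cells that may be removed from `S`. -/
noncomputable def remCells (S : Finset (ℕ × ℕ)) : Finset (ℕ × ℕ) :=
  S.filter fun c => ∀ d ∈ S, c ≤ d → d = c

lemma mem_addCells {S : Finset (ℕ × ℕ)} {c : ℕ × ℕ} :
    c ∈ addCells S ↔ c ∉ S ∧ ∀ d ≤ c, d ≠ c → d ∈ S := by
  refine ⟨fun h => ((@Finset.mem_filter _ _ (Classical.decPred _) _ _).1 h).2,
    fun h => (@Finset.mem_filter _ _ (Classical.decPred _) _ _).2 ⟨?_, h⟩⟩
  obtain ⟨a, b⟩ := c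
  rcases a with _ | a
  · rcases b with _ | b
    · simp
    · have := h.2 (0, b) ⟨le_rfl, by simp⟩ (by simp)
      simp only [Finset.mem_insert, Finset.mem_union, Finset.mem_image]
      exact Or.inr (Or.inr ⟨_, this, rfl⟩)
  · have := h.2 (a, b) ⟨by simp, le_rfl⟩ (by simp)
    simp only [Finset.mem_insert, Finset.mem_union, Finset.mem_image]
    exact Or.inr (Or.inl ⟨_, this, rfl⟩)

lemma mem_remCells {S : Finset (ℕ × ℕ)} {c : ℕ × ℕ} :
    c ∈ remCells S ↔ c ∈ S ∧ ∀ d ∈ S, c ≤ d → d = c := Finset.mem_filter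

lemma IsLow.insert {S : Finset (ℕ × ℕ)} (hS : IsLow S) {c : ℕ × ℕ} (hc : c ∈ addCells S) :
    IsLow (insert c S) := by
  intro d hd e he
  rcases Finset.mem_insert.1 hd with rfl | hd
  · by_cases h : e = d
    · exact h ▸ Finset.mem_insert_self _ _
    · exact Finset.mem_insert_of_mem ((mem_addCells.1 hc).2 e he h)
  · exact Finset.mem_insert_of_mem (hS d hd e he)

lemma IsLow.erase {S : Finset (ℕ × ℕ)} (hS : IsLow S) {c : ℕ × ℕ} (hc : c ∈ remCells S) :
    IsLow (S.erase c) := by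
  intro d hd e he
  rw [Finset.mem_erase] at hd ⊢
  exact ⟨fun h => hd.1 ((mem_remCells.1 hc).2 d hd.2 (h ▸ he)), hS d hd.2 e he⟩

lemma mem_remCells_insert {S : Finset (ℕ × ℕ)} (hS : IsLow S) {c : ℕ × ℕ} (hc : c ∈ addCells S) :
    c ∈ remCells (insert c S) := by
  refine mem_remCells.2 ⟨Finset.mem_insert_self _ _, fun d hd hcd => ?_⟩
  rcases Finset.mem_insert.1 hd with h | h
  · exact h
  · exact absurd (hS d h c hcd) (mem_addCells.1 hc).1

lemma mem_addCells_erase {S : Finset (ℕ × ℕ)} (hS : IsLow S) {c : ℕ × ℕ} (hc : c ∈ remCells S) :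
    c ∈ addCells (S.erase c) :=
  mem_addCells.2 ⟨Finset.notMem_erase _ _, fun d hd hne =>
    Finset.mem_erase.2 ⟨hne, hS c (mem_remCells.1 hc).1 d hd⟩⟩

lemma add_rem_comm {S : Finset (ℕ × ℕ)} {c d : ℕ × ℕ} (hne : d ≠ c) :
    (c ∈ addCells S ∧ d ∈ remCells (insert c S)) ↔ (d ∈ remCells S ∧ c ∈ addCells (S.erase d)) := by
  simp only [mem_addCells, mem_remCells, Finset.mem_insert, Finset.mem_erase]
  constructor
  · rintro ⟨⟨h₁, h₂⟩, h₃, h₄⟩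
    have h₃ := h₃.resolve_left hne
    refine ⟨⟨h₃, fun e he => h₄ e (Or.inr he)⟩, fun h => h₁ h.2, fun e he hec => ⟨?_, h₂ e he hec⟩⟩
    rintro rfl
    exact hne (h₄ c (Or.inl rfl) he).symm
  · rintro ⟨⟨h₁, h₂⟩, h₃, h₄⟩
    refine ⟨⟨fun h => h₃ ⟨hne.symm, h⟩, fun e he hec => (h₄ e he hec).2⟩, Or.inr h₁, ?_⟩
    rintro e (rfl | he) hde
    · exact absurd rfl (h₄ d hde hne).1
    · exact h₂ e he hde

lemma card_addCells {S : Finset (ℕ × ℕ)} (hS : IsLow S) :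
    (addCells S).card = (remCells S).card + 1 := by
  classical
  let μ : YoungDiagram := ⟨S, fun c d hdc hc => hS c hc d hdc⟩
  have hmem : ∀ a b, (a, b) ∈ S ↔ b < μ.rowLen a := fun a b => μ.mem_iff_lt_rowLen
  have hanti : ∀ a b, a ≤ b → μ.rowLen b ≤ μ.rowLen a := fun a b h => μ.rowLen_anti a b h
  generalize μ.rowLen = l at hmem hanti
  obtain ⟨K, hK⟩ : ∃ K, l K = 0 := by
    by_contra! h
    refine Set.infinite_of_injective_forall_mem (s := (S : Set (ℕ × ℕ)))
      (f := fun n : ℕ => (n, 0)) (fun a b h => by simpa using h) (fun n => ?_) S.finite_toSet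
    exact (hmem n 0).2 (Nat.pos_of_ne_zero (h n))
  have hK' : ∀ a, K ≤ a → l a = 0 := fun a h => Nat.le_zero.1 (hK ▸ hanti K a h)
  have hA : addCells S = ((Finset.range (K + 1)).filter fun a => a = 0 ∨ l a < l (a - 1)).image
      fun a => (a, l a) := by
    ext ⟨a, b⟩
    simp only [mem_addCells, Finset.mem_image, Finset.mem_filter, Finset.mem_range, Prod.mk.injEq,
      hmem, not_lt, Prod.forall, ne_eq, Prod.mk_le_mk]
    constructor
    · rintro ⟨h₁, h₂⟩
      have hb : l a = b := by
        rcases b with _ | b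
        · omega
        · have := h₂ a b ⟨le_rfl, by simp⟩ (by simp)
          omega
      have ha : a = 0 ∨ l a < l (a - 1) := by
        rcases a with _ | a
        · simp
        · have := h₂ a b ⟨by simp, le_rfl⟩ (by simp)
          right
          simpa [hb] using this
      refine ⟨a, ⟨?_, ha⟩, rfl, hb⟩
      by_contra h
      have h₁ := hK' (a - 1) (by omega)
      omega
    · rintro ⟨a, ⟨h₁, h₂⟩, rfl, rfl⟩
      refine ⟨le_rfl, fun x y h hne => ?_⟩
      by_cases hx : x = a
      · subst hx; simp at hne; omega
      · have := hanti x (a - 1) (by omega)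
        omega
  have hR : remCells S = ((Finset.range K).filter fun a => l (a + 1) < l a).image
      fun a => (a, l a - 1) := by
    ext ⟨a, b⟩
    simp only [mem_remCells, Finset.mem_image, Finset.mem_filter, Finset.mem_range, Prod.mk.injEq,
      hmem, Prod.forall, Prod.mk_le_mk]
    constructor
    · rintro ⟨h₁, h₂⟩
      have h₃ : ¬ b + 1 < l a := fun h => by simpa using h₂ a (b + 1) h ⟨le_rfl, by simp⟩
      have h₄ : ¬ b < l (a + 1) := fun h => by simpa using h₂ (a + 1) b h ⟨by simp, le_rfl⟩
      refine ⟨a, ⟨?_, by omega⟩, rfl, by omega⟩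
      by_contra h
      have := hK' a (by omega)
      omega
    · rintro ⟨a, ⟨h₁, h₂⟩, rfl, rfl⟩
      refine ⟨by omega, fun x y hy h => ?_⟩
      have h₃ := hanti a x h.1
      by_cases hx : x = a
      · subst hx; exact ⟨rfl, by omega⟩
      · have := hanti (a + 1) x (by omega)
        omega
  rw [hA, hR, Finset.card_image_of_injective _ (fun a b h => (Prod.mk.inj h).1),
    Finset.card_image_of_injective _ (fun a b h => (Prod.mk.inj h).1), Finset.card_filter,
    Finset.card_filter, Finset.sum_range_succ']
  simp

lemma isLow_shape {r : ℕ} (p : Tab r) : IsLow (shape p) := by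
  intro c hc d hd
  obtain ⟨j, rfl⟩ := mem_shape.1 hc
  obtain ⟨i, _, hi⟩ := p.2.down j d hd
  exact mem_shape.2 ⟨i, hi⟩

lemma IsStd.init {r : ℕ} {p : Fin (r + 1) → ℕ × ℕ} (hp : IsStd p) :
    IsStd (Fin.init p : Fin r → ℕ × ℕ) := by
  refine ⟨fun i j h => Fin.castSucc_injective _ (hp.inj h), fun j c hc => ?_⟩
  obtain ⟨i, hi, e⟩ := hp.down j.castSucc c hc
  refine ⟨i.castPred (fun h => ?_), ?_, ?_⟩
  · rw [h] at hi
    exact absurd hi (Fin.castSucc_lt_last j).not_ge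
  · rw [Fin.le_def] at hi ⊢
    exact hi
  · simpa [Fin.init] using e

lemma last_mem_addCells {r : ℕ} (p : Tab (r + 1)) :
    p.1 (Fin.last r) ∈ addCells (shape (⟨Fin.init p.1, p.2.init⟩ : Tab r)) := by
  rw [mem_addCells, mem_shape]
  refine ⟨fun ⟨j, hj⟩ => (Fin.castSucc_lt_last j).ne (p.2.inj hj), fun d hd hne => ?_⟩
  obtain ⟨i, _, e⟩ := p.2.down _ d hd
  have hi : i ≠ Fin.last r := fun h => hne (by rw [← e, h])
  exact mem_shape.2 ⟨i.castPred hi, by simpa [Fin.init] using e⟩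

lemma isStd_snoc {r : ℕ} (q : Tab r) {c : ℕ × ℕ} (hc : c ∈ addCells (shape q)) :
    IsStd (Fin.snoc q.1 c : Fin (r + 1) → ℕ × ℕ) := by
  rw [mem_addCells, mem_shape] at hc
  refine ⟨Fin.snoc_injective_iff.2 ⟨q.2.inj, fun ⟨j, hj⟩ => hc.1 ⟨j, hj⟩⟩, fun j d hd => ?_⟩
  induction j using Fin.lastCases with
  | last =>
    rw [Fin.snoc_last] at hd
    by_cases h : d = c
    · exact ⟨Fin.last r, le_rfl, by rw [Fin.snoc_last, h]⟩
    · obtain ⟨i, hi⟩ := mem_shape.1 (hc.2 d hd h)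
      exact ⟨i.castSucc, Fin.le_last _, by rw [Fin.snoc_castSucc, hi]⟩
  | cast j =>
    rw [Fin.snoc_castSucc] at hd
    obtain ⟨i, hi, e⟩ := q.2.down j d hd
    exact ⟨i.castSucc, by simpa using hi, by rw [Fin.snoc_castSucc, e]⟩

lemma shape_eq_insert {r : ℕ} (p : Tab (r + 1)) :
    shape p = insert (p.1 (Fin.last r)) (shape (⟨Fin.init p.1, p.2.init⟩ : Tab r)) := by
  ext d
  rw [mem_shape, Finset.mem_insert, mem_shape]
  constructor
  · rintro ⟨j, rfl⟩
    induction j using Fin.lastCases with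
    | last => exact Or.inl rfl
    | cast j => exact Or.inr ⟨j, rfl⟩
  · rintro (rfl | ⟨j, rfl⟩)
    · exact ⟨_, rfl⟩
    · exact ⟨j.castSucc, rfl⟩

lemma sum_tab_succ {r : ℕ} (g : Finset (ℕ × ℕ) → ℕ) :
    ∑ p : Tab (r + 1), g (shape p) = ∑ q : Tab r, ∑ c ∈ addCells (shape q),
      g (insert c (shape q)) := by
  rw [Finset.sum_sigma']
  refine Finset.sum_bij' (fun p _ => ⟨⟨Fin.init p.1, p.2.init⟩, p.1 (Fin.last r)⟩)
    (fun x hx => ⟨Fin.snoc x.1.1 x.2, isStd_snoc x.1 (Finset.mem_sigma.1 hx).2⟩)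
    (fun p _ => Finset.mem_sigma.2 ⟨Finset.mem_univ _, last_mem_addCells p⟩)
    (fun _ _ => Finset.mem_univ _) (fun p _ => Subtype.ext (Fin.snoc_init_self p.1))
    (fun x _ => ?_) (fun p _ => by rw [shape_eq_insert p])
  obtain ⟨q, c⟩ := x
  congr 1
  · exact Subtype.ext (Fin.init_snoc (α := fun _ => ℕ × ℕ) _ _)
  · exact Fin.snoc_last (α := fun _ => ℕ × ℕ) _ _

open Classical in
/-- The number of standard tableaux of a given shape. -/
noncomputable def numTab (r : ℕ) (S : Finset (ℕ × ℕ)) : ℕ :=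
  ∑ p : Tab r, if shape p = S then 1 else 0

lemma numTab_succ {r : ℕ} {S : Finset (ℕ × ℕ)} (hS : IsLow S) :
    numTab (r + 1) S = ∑ c ∈ remCells S, numTab r (S.erase c) := by
  classical
  unfold numTab
  rw [sum_tab_succ (fun S' => if S' = S then 1 else 0), Finset.sum_comm]
  refine Finset.sum_congr rfl fun q _ => ?_
  rw [← Finset.sum_filter, ← Finset.sum_filter]
  refine Finset.sum_congr ?_ fun _ _ => rfl
  ext c
  rw [Finset.mem_filter, Finset.mem_filter]
  constructor
  · rintro ⟨h, rfl⟩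
    exact ⟨mem_remCells_insert (isLow_shape q) h,
      (Finset.erase_insert (mem_addCells.1 h).1).symm⟩
  · rintro ⟨h, e⟩
    rw [e]
    exact ⟨mem_addCells_erase hS h, Finset.insert_erase (mem_remCells.1 h).1⟩

lemma numTab_zero (S : Finset (ℕ × ℕ)) : numTab 0 S = if S = ∅ then 1 else 0 := by
  classical
  have : Unique (Tab 0) :=
    { default := ⟨Fin.elim0, ⟨fun i => i.elim0, fun i => i.elim0⟩⟩
      uniq := fun p => Subtype.ext (funext fun i => i.elim0) }
  have h : shape (default : Tab 0) = ∅ := by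
    ext c
    simp [mem_shape]
  rw [numTab, Fintype.sum_unique, h]
  simp only [eq_comm]

lemma sum_numTab_insert_eq {r : ℕ} {S : Finset (ℕ × ℕ)} (hS : IsLow S) :
    ∑ c ∈ addCells S, numTab (r + 1) (insert c S) =
      (addCells S).card * numTab r S + ∑ c ∈ addCells S,
        ∑ d ∈ (remCells (insert c S)).erase c, numTab r ((insert c S).erase d) := by
  rw [← smul_eq_mul, ← Finset.sum_const, ← Finset.sum_add_distrib]
  refine Finset.sum_congr rfl fun c hc => ?_
  rw [numTab_succ (hS.insert hc), ← Finset.add_sum_erase _ _ (mem_remCells_insert hS hc),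
    Finset.erase_insert (mem_addCells.1 hc).1]

lemma sum_numTab_insert {r : ℕ} {S : Finset (ℕ × ℕ)} (hS : IsLow S) :
    ∑ c ∈ addCells S, numTab (r + 1) (insert c S) = (r + 1) * numTab r S := by
  classical
  induction r generalizing S with
  | zero =>
    rw [sum_numTab_insert_eq hS, Finset.sum_eq_zero, card_addCells hS, numTab_zero]
    · by_cases h : S = ∅
      · subst h
        simp [remCells]
      · simp [h]
    · intro c hc
      refine Finset.sum_eq_zero fun d hd => ?_
      rw [numTab_zero, if_neg]
      exact Finset.ne_empty_of_mem (a := c) (Finset.mem_erase.2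
        ⟨(Finset.ne_of_mem_erase hd).symm, Finset.mem_insert_self _ _⟩)
  | succ r ih =>
    have h₁ := sum_numTab_insert_eq (r := r + 1) hS
    have h₂ : (r + 1) * numTab (r + 1) S =
        (remCells S).card * numTab (r + 1) S + ∑ d ∈ remCells S,
          ∑ c ∈ (addCells (S.erase d)).erase d, numTab (r + 1) (insert c (S.erase d)) := by
      rw [numTab_succ hS, Finset.mul_sum, ← numTab_succ hS, ← smul_eq_mul, ← Finset.sum_const,
        ← Finset.sum_add_distrib]
      refine Finset.sum_congr rfl fun d hd => ?_
      rw [← ih (hS.erase hd), ← Finset.add_sum_erase _ _ (mem_addCells_erase hS hd),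
        Finset.insert_erase (mem_remCells.1 hd).1]
    have h₃ : ∑ c ∈ addCells S,
          ∑ d ∈ (remCells (insert c S)).erase c, numTab (r + 1) ((insert c S).erase d)
        = ∑ d ∈ remCells S,
          ∑ c ∈ (addCells (S.erase d)).erase d, numTab (r + 1) (insert c (S.erase d)) := by
      rw [Finset.sum_comm' (t' := remCells S) (s' := fun d => (addCells (S.erase d)).erase d)]
      · refine Finset.sum_congr rfl fun d _ => Finset.sum_congr rfl fun c hc => ?_
        rw [Finset.erase_insert_of_ne (Finset.ne_of_mem_erase hc)]
      · intro c d
        simp only [Finset.mem_erase]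
        constructor
        · rintro ⟨h₁, h₂, h₃⟩
          have := (add_rem_comm h₂).1 ⟨h₁, h₃⟩
          exact ⟨⟨h₂.symm, this.2⟩, this.1⟩
        · rintro ⟨⟨h₁, h₂⟩, h₃⟩
          have := (add_rem_comm h₁.symm).2 ⟨h₃, h₂⟩
          exact ⟨this.1, h₁.symm, this.2⟩
    rw [h₁, h₃, card_addCells hS]
    linarith [h₂]

lemma sum_numTab (r : ℕ) : ∑ p : Tab r, numTab r (shape p) = r.factorial := by
  induction r with
  | zero =>
    have : Unique (Tab 0) :=
      { default := ⟨Fin.elim0, ⟨fun i => i.elim0, fun i => i.elim0⟩⟩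
        uniq := fun p => Subtype.ext (funext fun i => i.elim0) }
    rw [Fintype.sum_unique, numTab_zero, if_pos, Nat.factorial_zero]
    ext c
    simp [mem_shape]
  | succ r ih =>
    rw [sum_tab_succ, Nat.factorial_succ, ← ih, Finset.mul_sum]
    exact Finset.sum_congr rfl fun q _ => sum_numTab_insert (isLow_shape q)

lemma card_tabPair (r : ℕ) : Nat.card (TabPair r fun _ => True) = r.factorial := by
  classical
  rw [← sum_numTab]
  unfold numTab
  rw [Nat.card_eq_fintype_card, Fintype.card_subtype, Finset.card_filter,
    ← Finset.univ_product_univ, Finset.sum_product]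
  refine Finset.sum_congr rfl fun p _ => Finset.sum_congr rfl fun q _ => ?_
  simp [eq_comm]

end Branching

section Faithful

variable {R : ℕ} {t : ℂ}

lemma vanish_top (x : FreeAlgebra ℂ (Fin R)) :
    x ∈ vanish t R (fun _ => True) ↔ repV t R x = 0 :=
  ⟨fun h => LinearMap.ext fun f => funext fun p => h f p trivial, fun h f p _ => by simp [h]⟩

lemma ker_eq_bot_of_le_finrank_range {A S E : Type*} [AddCommGroup A] [Module ℂ A]
    [AddCommGroup S] [Module ℂ S] [FiniteDimensional ℂ S] [AddCommGroup E] [Module ℂ E]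
    (L : A →ₗ[ℂ] S) (F : S →ₗ[ℂ] E)
    (h : Module.finrank ℂ S ≤ Module.finrank ℂ (LinearMap.range (F ∘ₗ L))) :
    LinearMap.ker F = ⊥ := by
  have h₁ := F.finrank_range_add_finrank_ker
  have h₂ := Submodule.finrank_mono (LinearMap.range_comp_le_range L F)
  exact Submodule.finrank_eq_zero.1 (by omega)

/-- The seminormal representation is universal: an element of the free algebra killing it kills
every module over the Hecke algebra. -/
lemma lift_apply_eq_zero (ht : Generic t) {W : Type*} [AddCommGroup W] [Module ℂ W]
    {T : Fin R → Module.End ℂ W} (hT : HeckeRel (t - t⁻¹) T) {x : FreeAlgebra ℂ (Fin R)}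
    (hx : repV t R x = 0) : FreeAlgebra.lift ℂ T x = 0 := by
  refine LinearMap.ext fun w => ?_
  set ρ := FreeAlgebra.lift ℂ T with hρ
  let TM : Fin R → Module.End ℂ (Module.End ℂ (Tab (R + 1) → ℂ) × W) := fun i =>
    LinearMap.prodMap (LinearMap.mulLeft ℂ (opV t i)) (T i)
  have hV := opV_heckeRel (R := R) ht
  have hM : HeckeRel (t - t⁻¹) TM := by
    refine ⟨fun i => ?_, fun i j h => ?_, fun i j h => ?_⟩ <;> refine LinearMap.ext fun s => ?_
    · refine Prod.ext ?_ ?_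
      · simp [TM, ← mul_assoc, hV.quad, add_mul]
      · exact LinearMap.congr_fun (hT.quad i) s.2
    · refine Prod.ext ?_ ?_
      · simp [TM, ← mul_assoc, hV.braid i j h]
      · exact LinearMap.congr_fun (hT.braid i j h) s.2
    · refine Prod.ext ?_ ?_
      · simp [TM, ← mul_assoc, hV.comm i j h]
      · exact LinearMap.congr_fun (hT.comm i j h) s.2
  obtain ⟨S, hvS, hST, hfd, hcard⟩ := exists_stable_finrank_le hM (1, w)
  have hmem : ∀ y : FreeAlgebra ℂ (Fin R), ∀ s ∈ S, (repV t R y * s.1, ρ y s.2) ∈ S := by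
    intro y
    induction y using FreeAlgebra.induction with
    | grade0 c =>
      intro s hs
      have : (repV t R (algebraMap ℂ _ c) * s.1, ρ (algebraMap ℂ _ c) s.2) = c • s := by
        rw [AlgHom.commutes, AlgHom.commutes]
        refine Prod.ext ?_ ?_ <;> simp [Algebra.algebraMap_eq_smul_one]
      rw [this]
      exact S.smul_mem c hs
    | grade1 i =>
      intro s hs
      have := hST i s hs
      simpa [TM, hρ] using this
    | mul a b ha hb =>
      intro s hs
      simpa [mul_assoc] using ha _ (hb s hs)
    | add a b ha hb =>
      intro s hs
      simpa [add_mul] using S.add_mem (ha s hs) (hb s hs)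
  let L : FreeAlgebra ℂ (Fin R) →ₗ[ℂ] S :=
    LinearMap.codRestrict S ((repV t R).toLinearMap.prod (LinearMap.applyₗ w ∘ₗ ρ.toLinearMap))
      fun y => by simpa using hmem y _ hvS
  let F : S →ₗ[ℂ] Module.End ℂ (Tab (R + 1) → ℂ) := LinearMap.fst ℂ _ W ∘ₗ S.subtype
  have hFL : F ∘ₗ L = (repV t R).toLinearMap := rfl
  have hk : LinearMap.ker (repV t R).toLinearMap = vanish t R fun _ => True := by
    ext y
    rw [vanish_top]
    rfl
  have hker : LinearMap.ker F = ⊥ := by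
    refine ker_eq_bot_of_le_finrank_range (S := S)
      (E := (Tab (R + 1) → ℂ) →ₗ[ℂ] (Tab (R + 1) → ℂ)) L F ?_
    rwa [hFL, ← (repV t R).toLinearMap.quotKerEquivRange.finrank_eq, hk,
      finrank_quotient_vanish ht, card_tabPair]
  have h := LinearMap.ker_eq_bot'.1 hker (L x) hx
  exact congrArg (fun s : S => s.1.2) h

end Faithful

section Kernel

variable {R : ℕ} {t : ℂ} {m n : ℕ}

/-- The tensor space representation of the free algebra. -/
noncomputable def repW (t : ℂ) (m n R : ℕ) :
    FreeAlgebra ℂ (Fin R) →ₐ[ℂ] Module.End ℂ ((Fin (R + 1) → Fin (m + n)) → ℂ) :=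
  FreeAlgebra.lift ℂ (opW t m (m + n))

@[simp] lemma repW_ι (i : Fin R) : repW t m n R (FreeAlgebra.ι ℂ i) = opW t m (m + n) i := by
  simp [repW]

lemma opW_single {N : ℕ} (i : Fin R) (a : Fin (R + 1) → Fin N) :
    opW t m N i (Pi.single a 1) =
      coefA (t - t⁻¹) (eig t m) (a i.castSucc) (a i.succ) • Pi.single a 1
      + coefB (sgn ℂ m) (a i.castSucc) (a i.succ) • Pi.single (sw i a) 1 :=
  lopEnd_single _ _ (fun k l => by simp only [coefB, sgn_comm m k l, eq_comm]) i a

/-- A family of eigenvectors indexed by the weakly decreasing words defines a homomorphism out of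
tensor space. -/
lemma exists_intertwiner {N : ℕ} {M : Type*} [AddCommGroup M] [Module ℂ M]
    {T : Fin R → Module.End ℂ M} (hT : HeckeRel (t - t⁻¹) T) (u : (Fin (R + 1) → Fin N) → M)
    (hu : ∀ a, Antitone a → ∀ i : Fin R, a i.castSucc = a i.succ →
      T i (u a) = eig t m (a i.castSucc) • u a) :
    ∃ Φ : ((Fin (R + 1) → Fin N) → ℂ) →ₗ[ℂ] M, (∀ i w, T i (Φ w) = Φ (opW t m N i w)) ∧
      ∀ a, Antitone a → Φ (Pi.single a 1) = u a := by
  have h : ∀ a, ((Pi.basisFun ℂ (Fin (R + 1) → Fin N)).constr ℂ (wordMap (sgn ℂ m) T u))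
      (Pi.single a 1) = wordMap (sgn ℂ m) T u a := fun a => by
    rw [← Pi.basisFun_apply, Module.Basis.constr_basis]
  refine ⟨(Pi.basisFun ℂ (Fin (R + 1) → Fin N)).constr ℂ (wordMap (sgn ℂ m) T u), fun i w => ?_,
    fun a ha => by rw [h, wordMap_antitone ha]⟩
  generalize (Pi.basisFun ℂ (Fin (R + 1) → Fin N)).constr ℂ (wordMap (sgn ℂ m) T u) = Φ at h
  have : T i ∘ₗ Φ = Φ ∘ₗ opW t m N i := by
    refine (Pi.basisFun ℂ _).ext fun a => ?_
    rw [Pi.basisFun_apply, LinearMap.comp_apply, LinearMap.comp_apply, opW_single, map_add,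
      map_smul, map_smul, h, h, wordMap_apply hT (sgn_mul_self m) (sgn_comm m) hu]
  exact LinearMap.congr_fun this w

/-- A hook-shaped collection of cells has a standard tableau whose cells can be labelled by
letters in weakly decreasing order so that consecutive cells with the same letter are adjacent in a
row (even letters) or in a column (odd letters). -/
lemma exists_hook_labelling (p : Tab (R + 1)) (hp : (m, n) ∉ shape p) :
    ∃ q : Tab (R + 1), shape q = shape p ∧ ∃ b : Fin (R + 1) → Fin (m + n), Antitone b ∧
      ∀ i : Fin R, b i.castSucc = b i.succ →
        ((b i.castSucc : ℕ) < m ∧ content (q.1 i.succ) = content (q.1 i.castSucc) + 1) ∨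
        (¬ (b i.castSucc : ℕ) < m ∧ content (q.1 i.succ) = content (q.1 i.castSucc) - 1) := by
  let g : ℕ × ℕ → ℕ := fun c => if c.2 < n then c.2 else n + c.1
  let h : ℕ × ℕ → ℕ := fun c => if c.2 < n then c.1 else c.2
  let κ : ℕ × ℕ → ℕ := fun c => g c * (R + 1) + min (h c) R
  have hgh : ∀ c d, c ≤ d → g c < g d ∨ g c = g d ∧ h c ≤ h d := by
    rintro ⟨a, b⟩ ⟨a', b'⟩ hcd
    have h₁ : a ≤ a' := hcd.1
    have h₂ : b ≤ b' := hcd.2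
    simp only [g, h]
    split_ifs <;> omega
  have hκ : Monotone κ := by
    intro c d hcd
    simp only [κ]
    rcases hgh c d hcd with h₁ | ⟨h₁, h₂⟩
    · have := Nat.mul_le_mul_right (R + 1) (Nat.succ_le_of_lt h₁)
      rw [Nat.succ_mul] at this
      omega
    · rw [h₁]
      omega
  obtain ⟨q, hq, hs⟩ := exists_sorted (B := fun _ => True) (P := fun q => shape q = shape p)
    (κ := fun _ => κ) (fun _ => hκ) (fun _ _ => rfl)
    (fun i _ p q hpq h => (shape_sw hpq).trans h) ⟨p, rfl⟩
  have hg : ∀ j, g (q.1 j) < m + n := by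
    intro j
    have h₁ : ¬ (m, n) ≤ q.1 j := fun hle => hp (hq ▸ isLow_shape q _ (mem_shape.2 ⟨j, rfl⟩) _ hle)
    simp only [Prod.le_def] at h₁
    simp only [g]
    split_ifs <;> omega
  have hh : ∀ j, h (q.1 j) ≤ R := by
    intro j
    have h₁ := q.2.fst_le j
    have h₂ := q.2.snd_le j
    have h₃ := j.2
    simp only [h]
    split_ifs <;> omega
  have hstep : ∀ i : Fin R, g (q.1 i.castSucc) < g (q.1 i.succ) ∨
      g (q.1 i.castSucc) = g (q.1 i.succ) ∧ h (q.1 i.castSucc) ≤ h (q.1 i.succ) := by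
    intro i
    have h₁ := hs i trivial
    have h₂ := hh i.castSucc
    have h₃ := hh i.succ
    simp only [κ] at h₁
    rcases lt_trichotomy (g (q.1 i.castSucc)) (g (q.1 i.succ)) with h₄ | h₄ | h₄
    · exact Or.inl h₄
    · rw [h₄] at h₁
      exact Or.inr ⟨h₄, by omega⟩
    · have := Nat.mul_le_mul_right (R + 1) (Nat.succ_le_of_lt h₄)
      rw [Nat.succ_mul] at this
      omega
  refine ⟨q, hq, fun j => ⟨m + n - 1 - g (q.1 j), by have := hg j; omega⟩, ?_, fun i hi => ?_⟩
  · refine Fin.antitone_iff_succ_le.2 fun i => Fin.le_def.2 ?_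
    have := hstep i
    simp only
    omega
  · have h₁ := hstep i
    have h₂ := hg i.castSucc
    have h₃ := hg i.succ
    simp only [Fin.mk.injEq] at hi
    have h₄ : g (q.1 i.castSucc) = g (q.1 i.succ) := by omega
    have h₅ : h (q.1 i.castSucc) ≤ h (q.1 i.succ) := by omega
    have hne : q.1 i.castSucc ≠ q.1 i.succ := fun e => i.castSucc_lt_succ.ne (q.2.inj e)
    have hle : q.1 i.castSucc ≤ q.1 i.succ := by
      simp only [g, h] at h₄ h₅
      rw [Prod.le_def]
      split_ifs at h₄ h₅ <;> omega
    simp only [content]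
    rcases q.2.adj hle with e | e
    all_goals
      have e₁ := congrArg Prod.fst e
      have e₂ := congrArg Prod.snd e
      simp only at e₁ e₂
      simp only [g] at h₂ h₄ ⊢
      split_ifs at h₂ h₄ ⊢ <;> omega

open Classical in
lemma opV_single_of_content {q : Tab (R + 1)} {i : Fin R}
    (h : content (q.1 i.succ) = content (q.1 i.castSucc) + 1 ∨
      content (q.1 i.succ) = content (q.1 i.castSucc) - 1) :
    opV t i (Pi.single q 1) = tabA t (q.1 i.castSucc) (q.1 i.succ) • Pi.single q 1 := by
  funext p
  rw [opV_apply, Pi.smul_apply, smul_eq_mul]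
  by_cases hp : p = q
  · subst hp
    rw [tabB, if_pos h, zero_mul, add_zero]
  · rw [Pi.single_eq_of_ne hp, mul_zero, mul_zero, zero_add]
    by_cases hs : IsStd (sw i p.1)
    · rw [show sw i p.1 = (⟨sw i p.1, hs⟩ : Tab (R + 1)).1 from rfl, zext_coe,
        Pi.single_eq_of_ne, mul_zero]
      rintro rfl
      exact hs.content_of_sw (i := i) (by rw [sw_sw]; exact p.2) h
    · rw [zext_of_not _ hs, mul_zero]

/-- Elements acting by zero on tensor space act by zero on all hook-shaped tableaux. -/
lemma mem_vanish_of_repW_eq_zero (ht : Generic t) {x : FreeAlgebra ℂ (Fin R)}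
    (hx : repW t m n R x = 0) : x ∈ vanish t R fun S => (m, n) ∉ S := by
  classical
  rw [mem_vanish]
  intro p p' hpp hp
  obtain ⟨q, hq, b, hb, hbq⟩ := exists_hook_labelling p hp
  obtain ⟨Φ, hΦ, hΦb⟩ := exists_intertwiner (m := m) (opV_heckeRel (R := R) ht)
    (fun a : Fin (R + 1) → Fin (m + n) =>
      if a = b then (Pi.single q 1 : Tab (R + 1) → ℂ) else 0) (by
      intro a _ i hi
      by_cases hab : a = b
      · subst hab
        rw [if_pos rfl]
        rcases hbq i hi with ⟨h₁, h₂⟩ | ⟨h₁, h₂⟩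
        · rw [opV_single_of_content (Or.inl h₂), eig, if_pos h₁, tabA_row ht h₂]
        · rw [opV_single_of_content (Or.inr h₂), eig, if_neg h₁, tabA_col ht h₂]
      · rw [if_neg hab, map_zero, smul_zero])
  have hcomm : ∀ (y : FreeAlgebra ℂ (Fin R)) w, repV t R y (Φ w) = Φ (repW t m n R y w) := by
    intro y
    induction y using FreeAlgebra.induction with
    | grade0 c => intro w; simp [Algebra.algebraMap_eq_smul_one]
    | grade1 i => intro w; rw [repV_ι, repW_ι, hΦ]
    | mul a c ha hc => intro w; simp only [map_mul, Module.End.mul_apply, ha, hc]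
    | add a c ha hc => intro w; simp only [map_add, LinearMap.add_apply, ha, hc]
  obtain ⟨y, hy⟩ := unitV_mem ht (p := p') (q := q) (hpp.symm.trans hq.symm)
  change repV t R y = _ at hy
  have h := hcomm (x * y) (Pi.single b 1)
  rw [map_mul, map_mul, hx, zero_mul, LinearMap.zero_apply, map_zero, hΦb b hb, if_pos rfl, hy,
    Module.End.mul_apply, unitV_apply, Pi.single_eq_same] at h
  exact congrFun h p

end Kernel

section NonHook

variable {R : ℕ} {t : ℂ} {m n : ℕ}

lemma lt_of_block {N : ℕ} {b : Fin (R + 1) → Fin N} (hb : Antitone b) {f : Fin (R + 1) → ℕ}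
    (hf : ∀ i : Fin R, b i.castSucc = b i.succ → f i.castSucc < f i.succ) {i j : Fin (R + 1)}
    (hij : i < j) (h : b i = b j) : f i < f j := by
  induction j using Fin.induction with
  | zero => exact absurd hij (Fin.not_lt_zero i)
  | succ j ih =>
    have hle : i ≤ j.castSucc := Fin.le_castSucc_iff.2 hij
    have h₁ : b i = b j.castSucc := le_antisymm (h ▸ hb j.castSucc_lt_succ.le) (hb hle)
    have h₂ := hf j (h₁ ▸ h)
    rcases hle.eq_or_lt with rfl | hlt
    · exact h₂
    · exact (ih hlt h₁).trans h₂

/-- A tableau containing the cell `(m, n)` cannot be labelled by `m` even and `n` odd letters in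
weakly decreasing order, with at most one cell of each even letter in every column and at most one
cell of each odd letter in every row. -/
lemma not_mem_shape_of_labelling {p : Tab (R + 1)} {b : Fin (R + 1) → Fin (m + n)}
    (hb : Antitone b)
    (h : ∀ i j, i < j → b i = b j → if (b i : ℕ) < m then (p.1 i).2 < (p.1 j).2
      else (p.1 i).1 < (p.1 j).1) : (m, n) ∉ shape p := by
  intro hmn
  have hmem : ∀ x y, x ≤ m → y ≤ n → ∃ j, p.1 j = (x, y) := fun x y hx hy =>
    mem_shape.1 (isLow_shape p _ hmn (x, y) ⟨hx, hy⟩)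
  have hlt : ∀ i j, p.1 i ≤ p.1 j → p.1 i ≠ p.1 j → i < j := fun i j h₁ h₂ =>
    lt_of_le_of_ne (p.2.le_of_le h₁) fun e => h₂ (e ▸ rfl)
  have row : ∀ y ≤ n, ∀ j, p.1 j = (0, y) → (b j : ℕ) < m ∨ (b j : ℕ) + y < m + n := by
    intro y
    induction y with
    | zero => exact fun _ j _ => Or.inr (b j).2
    | succ y ih =>
      intro hy j hj
      obtain ⟨i, hi⟩ := hmem 0 y (Nat.zero_le _) (by omega)
      have hij : i < j := hlt i j (by rw [hi, hj]; exact ⟨le_rfl, Nat.le_succ _⟩) (by simp [hi, hj])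
      have h₁ := Fin.le_def.1 (hb hij.le)
      have h₂ := h i j hij
      have h₃ := ih (by omega) i hi
      rw [hi, hj, Fin.ext_iff] at h₂
      split_ifs at h₂ with h₄
      · omega
      · simp only [lt_irrefl, imp_false] at h₂
        omega
  have col : ∀ x ≤ m, ∀ j, p.1 j = (x, n) → (b j : ℕ) + x < m := by
    intro x
    induction x with
    | zero =>
      intro _ j hj
      have h₁ := row n le_rfl j hj
      omega
    | succ x ih =>
      intro hx j hj
      obtain ⟨i, hi⟩ := hmem x n (by omega) le_rfl
      have hij : i < j := hlt i j (by rw [hi, hj]; exact ⟨Nat.le_succ _, le_rfl⟩) (by simp [hi, hj])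
      have h₁ := Fin.le_def.1 (hb hij.le)
      have h₂ := h i j hij
      have h₃ := ih (by omega) i hi
      rw [hi, hj, Fin.ext_iff, if_pos (by omega)] at h₂
      simp only [lt_irrefl, imp_false] at h₂
      omega
  obtain ⟨j, hj⟩ := hmem m n le_rfl le_rfl
  have := col m le_rfl j hj
  omega

lemma unitV_mul_opV (i : Fin R) (s p q : Tab (R + 1)) (hq : q.1 = sw i p.1) :
    unitV s p * opV t i = tabA t (p.1 i.castSucc) (p.1 i.succ) • unitV s p
      + tabB t (p.1 i.castSucc) (p.1 i.succ) • unitV s q := by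
  classical
  refine LinearMap.ext fun f => ?_
  rw [Module.End.mul_apply, LinearMap.add_apply, LinearMap.smul_apply, LinearMap.smul_apply,
    unitV_apply, unitV_apply, unitV_apply, opV_apply, ← hq, zext_coe, ← Pi.single_smul,
    ← Pi.single_smul, ← Pi.single_add, smul_eq_mul, smul_eq_mul]

lemma unitV_mul_opV_of_content (i : Fin R) (s p : Tab (R + 1))
    (h : content (p.1 i.succ) = content (p.1 i.castSucc) + 1 ∨
      content (p.1 i.succ) = content (p.1 i.castSucc) - 1) :
    unitV s p * opV t i = tabA t (p.1 i.castSucc) (p.1 i.succ) • unitV s p := by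
  classical
  refine LinearMap.ext fun f => ?_
  rw [Module.End.mul_apply, LinearMap.smul_apply, unitV_apply, unitV_apply, opV_apply, tabB,
    if_pos h, zero_mul, add_zero, ← Pi.single_smul, smul_eq_mul]

lemma tabA_ne (ht : Generic t) {c d : ℕ × ℕ} (h : content c ≠ content d)
    (h₁ : ¬ (content d = content c + 1 ∨ content d = content c - 1)) :
    tabA t c d ≠ t ∧ tabA t c d ≠ -t⁻¹ := by
  have h₂ := tabB_ne_zero ht h h₁
  have h₃ := tabB_ne_zero ht h.symm (by omega)
  rw [tabB, if_neg h₁] at h₂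
  rw [tabB, if_neg (by omega)] at h₃
  refine ⟨fun e => h₂ (by rw [e, sub_self]), fun e => h₃ ?_⟩
  have := tabA_add ht h
  rw [e] at this
  linear_combination -this

lemma Generic.ne_neg_inv (ht : Generic t) : t ≠ -t⁻¹ := by
  intro h
  have h₀ := ht.ne_zero
  have h₁ : t ^ 2 = -1 := by
    field_simp at h
    exact h
  exact ht.pow_ne_one 4 (by norm_num) (by rw [show 4 = 2 * 2 from rfl, pow_mul, h₁]; norm_num)

/-- The matrix units attached to non-hook tableaux kill the weakly decreasing words. -/
lemma repW_single_eq_zero (ht : Generic t) {s : Tab (R + 1)} (hs : (m, n) ∈ shape s)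
    {y : FreeAlgebra ℂ (Fin R)} (hy : repV t R y = unitV s s) {b : Fin (R + 1) → Fin (m + n)}
    (hb : Antitone b) : repW t m n R y (Pi.single b 1) = 0 := by
  set w : (Fin (R + 1) → Fin (m + n)) → ℂ := Pi.single b 1 with hw
  have hker : ∀ x x' : FreeAlgebra ℂ (Fin R), repV t R x = repV t R x' →
      repW t m n R x = repW t m n R x' := fun x x' h => by
    rw [← sub_eq_zero, ← map_sub] at h ⊢
    exact lift_apply_eq_zero ht (opW_heckeRel ht.ne_zero m (m + n)) h
  have hTw : ∀ i : Fin R, b i.castSucc = b i.succ →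
      opW t m (m + n) i w = eig t m (b i.castSucc) • w := by
    intro i hi
    rw [hw, opW_single, ← hi, coefA, coefB, if_neg (lt_irrefl _), if_pos rfl, if_pos rfl,
      zero_smul, add_zero]
  by_contra hne
  let P : Tab (R + 1) → Prop := fun p => shape p = shape s ∧
    ∃ y, repV t R y = unitV s p ∧ repW t m n R y w ≠ 0
  let F : Fin (R + 1) → ℕ × ℕ → ℕ := fun j c => if (b j : ℕ) < m then c.2 else c.1
  let G : Fin (R + 1) → ℕ × ℕ → ℕ := fun j c => if (b j : ℕ) < m then c.1 else c.2
  let κ : Fin (R + 1) → ℕ × ℕ → ℕ := fun j c => F j c * (R + 1) + G j c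
  have hκ : ∀ k, Monotone (κ k) := by
    intro k c d hcd
    refine add_le_add (Nat.mul_le_mul_right _ ?_) ?_ <;> simp only [F, G] <;> split_ifs <;>
      first | exact hcd.1 | exact hcd.2
  obtain ⟨p, ⟨hp, y, hyp, hyw⟩, hsort⟩ := exists_sorted (P := P) (κ := κ)
    (B := fun i => b i.castSucc = b i.succ) hκ
    (fun i hi => by simp only [κ, F, G, hi]) (by
      rintro i hi p q hpq ⟨hp, y, hyp, hyw⟩
      have hq := (shape_sw hpq).trans hp
      obtain ⟨y', hy'⟩ := unitV_mem ht (p := s) (q := q) hq.symm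
      change repV t R y' = _ at hy'
      refine ⟨hq, y', hy', fun h0 => ?_⟩
      have h₁ := hker (y * FreeAlgebra.ι ℂ i)
        (tabA t (p.1 i.castSucc) (p.1 i.succ) • y + tabB t (p.1 i.castSucc) (p.1 i.succ) • y')
        (by rw [map_mul, hyp, repV_ι, unitV_mul_opV i s p q hpq, map_add, map_smul, map_smul, hyp,
          hy'])
      have h₂ := LinearMap.congr_fun h₁ w
      rw [map_mul, repW_ι, Module.End.mul_apply, hTw i hi, map_smul, map_add, map_smul, map_smul,
        LinearMap.add_apply, LinearMap.smul_apply, LinearMap.smul_apply, h0, smul_zero,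
        add_zero] at h₂
      have h₃ := smul_left_injective ℂ hyw h₂
      have h₄ := tabA_ne ht (p.2.content_ne i)
        (p.2.content_of_sw (i := i) (by rw [← hpq]; exact q.2))
      rw [← h₃, eig] at h₄
      split_ifs at h₄
      · exact h₄.1 rfl
      · exact h₄.2 rfl) ⟨s, rfl, y, hy, hne⟩
  have hF : ∀ i : Fin R, b i.castSucc = b i.succ →
      F i.castSucc (p.1 i.castSucc) < F i.succ (p.1 i.succ) := by
    intro i hi
    have hadj : ∀ (_ : content (p.1 i.succ) = content (p.1 i.castSucc) + 1 ∨
        content (p.1 i.succ) = content (p.1 i.castSucc) - 1),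
        eig t m (b i.castSucc) = tabA t (p.1 i.castSucc) (p.1 i.succ) := by
      intro h
      have h₁ := hker (y * FreeAlgebra.ι ℂ i) (tabA t (p.1 i.castSucc) (p.1 i.succ) • y)
        (by rw [map_mul, hyp, repV_ι, unitV_mul_opV_of_content i s p h, map_smul, hyp])
      have h₂ := LinearMap.congr_fun h₁ w
      rw [map_mul, repW_ι, Module.End.mul_apply, hTw i hi, map_smul, map_smul,
        LinearMap.smul_apply] at h₂
      exact smul_left_injective ℂ hyw h₂
    have hG : ∀ j k, G j (p.1 k) < R + 1 := by
      intro j k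
      simp only [G]
      split_ifs
      · exact (p.2.fst_le k).trans_lt k.2
      · exact (p.2.snd_le k).trans_lt k.2
    have hle := hsort i hi
    have h₁ := hG i.castSucc i.castSucc
    have h₂ := hG i.succ i.succ
    simp only [κ] at hle
    rcases lt_trichotomy (F i.castSucc (p.1 i.castSucc)) (F i.succ (p.1 i.succ)) with h₃ | h₃ | h₃
    · exact h₃
    · exfalso
      rw [h₃] at hle
      have h₄ : G i.castSucc (p.1 i.castSucc) ≤ G i.succ (p.1 i.succ) := by omega
      simp only [F, G, ← hi] at h₃ h₄
      by_cases hm : (b i.castSucc : ℕ) < m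
      · rw [if_pos hm, if_pos hm] at h₃ h₄
        have hc : content (p.1 i.succ) = content (p.1 i.castSucc) - 1 := by
          rcases p.2.adj (i := i) ⟨h₄, h₃.le⟩ with e | e
          · rw [e] at h₃; simp at h₃
          · simp only [content, e]; push_cast; ring
        have := hadj (Or.inr hc)
        rw [eig, if_pos hm, tabA_col ht hc] at this
        exact ht.ne_neg_inv this
      · rw [if_neg hm, if_neg hm] at h₃ h₄
        have hc : content (p.1 i.succ) = content (p.1 i.castSucc) + 1 := by
          rcases p.2.adj (i := i) ⟨h₃.le, h₄⟩ with e | e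
          · simp only [content, e]; push_cast; ring
          · rw [e] at h₃; simp at h₃
        have := hadj (Or.inl hc)
        rw [eig, if_neg hm, tabA_row ht hc] at this
        exact ht.ne_neg_inv this.symm
    · have := Nat.mul_le_mul_right (R + 1) (Nat.succ_le_of_lt h₃)
      rw [Nat.succ_mul] at this
      omega
  refine not_mem_shape_of_labelling (p := p) hb (fun i j hij hbij => ?_) (hp ▸ hs)
  have := lt_of_block hb (f := fun j => F j (p.1 j)) hF hij hbij
  simp only [F, ← hbij] at this
  split_ifs at this ⊢ <;> exact this

/-- Elements acting by zero on all hook-shaped tableaux act by zero on tensor space. -/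
lemma repW_eq_zero_of_mem_vanish (ht : Generic t) {x : FreeAlgebra ℂ (Fin R)}
    (hx : x ∈ vanish t R fun S => (m, n) ∉ S) : repW t m n R x = 0 := by
  classical
  have hzero : ∀ x : FreeAlgebra ℂ (Fin R), repV t R x = 0 → repW t m n R x = 0 := fun x h =>
    lift_apply_eq_zero ht (opW_heckeRel ht.ne_zero m (m + n)) h
  choose y hy using fun p : Tab (R + 1) => unitV_self_mem ht p
  change ∀ p, repV t R (y p) = _ at hy
  have hone : repW t m n R 1 = ∑ p, repW t m n R (y p) := by
    rw [← map_sum, ← sub_eq_zero, ← map_sub]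
    refine hzero _ (LinearMap.ext fun f => funext fun q => ?_)
    rw [map_sub, map_sum, map_one, LinearMap.sub_apply, LinearMap.sum_apply, Pi.sub_apply,
      Finset.sum_apply]
    simp [hy, unitV_apply, Pi.single_apply]
  refine (Pi.basisFun ℂ _).ext fun a => ?_
  rw [Pi.basisFun_apply, LinearMap.zero_apply]
  refine word_induction (t := t) (m := m)
    (fun w => ∀ x ∈ vanish t R fun S => (m, n) ∉ S, repW t m n R x w = 0)
    (fun c v hv x hx => by rw [map_smul, hv x hx, smul_zero]) (fun i v hv x hx => ?_)
    (fun b hb x hx => ?_) a x hx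
  · rw [← repW_ι, ← Module.End.mul_apply, ← map_mul]
    refine hv _ fun f p hp => ?_
    rw [map_mul, Module.End.mul_apply]
    exact hx _ p hp
  · rw [← mul_one x, map_mul, hone, Finset.mul_sum, LinearMap.sum_apply]
    refine Finset.sum_eq_zero fun s _ => ?_
    by_cases hs : (m, n) ∈ shape s
    · rw [Module.End.mul_apply, repW_single_eq_zero ht hs (hy s) hb, map_zero]
    · rw [← map_mul, hzero, LinearMap.zero_apply]
      refine LinearMap.ext fun f => funext fun p => ?_
      rw [map_mul, hy, Module.End.mul_apply, unitV_apply]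
      by_cases hp : shape p = shape s
      · exact hx _ p (hp ▸ hs)
      · exact repV_local x fun q hq => Pi.single_eq_of_ne (fun e => hp (by rw [← hq, e])) _

lemma ker_repW (ht : Generic t) :
    LinearMap.ker (repW t m n R).toLinearMap = vanish t R fun S => (m, n) ∉ S :=
  le_antisymm (fun _ hx => mem_vanish_of_repW_eq_zero ht hx)
    fun _ hx => repW_eq_zero_of_mem_vanish ht hx

lemma finrank_St (ht : Generic t) :
    Module.finrank ℂ (St t m n (R + 1)) = Nat.card (TabPair (R + 1) fun S => (m, n) ∉ S) := by
  have hgens : heckeGens t t⁻¹ m (N := m + n) (R + 1) =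
      Set.range fun i : Fin R => LinearMap.toMatrixAlgEquiv' (opW t m (m + n) i) := by
    ext M
    constructor
    · rintro ⟨i, h, rfl⟩
      exact ⟨⟨i, by omega⟩, (heckeOp_eq_toMatrix t m ⟨i, by omega⟩).symm⟩
    · rintro ⟨i, rfl⟩
      exact ⟨i, Nat.succ_lt_succ i.2, (heckeOp_eq_toMatrix t m i).symm⟩
  have hSt : St t m n (R + 1) = (repW t m n R).range.map
      (LinearMap.toMatrixAlgEquiv' (R := ℂ) (n := Fin (R + 1) → Fin (m + n))).toAlgHom := by
    rw [St, hgens, repW, ← Algebra.adjoin_range_eq_range_freeAlgebra_lift, AlgHom.map_adjoin,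
      ← Set.range_comp]
    rfl
  rw [hSt, ← finrank_quotient_vanish ht, ← ker_repW ht,
    (repW t m n R).toLinearMap.quotKerEquivRange.finrank_eq]
  exact (((repW t m n R).range.equivMapOfInjective
    (LinearMap.toMatrixAlgEquiv' (R := ℂ) (n := Fin (R + 1) → Fin (m + n))).toAlgHom
    (AlgEquiv.injective _)).toLinearEquiv.finrank_eq).symm

end NonHook

section Partitions

variable {r : ℕ}

lemma card_shape (p : Tab r) : (shape p).card = r := by
  rw [shape, Finset.card_image_of_injective _ p.2.inj, Finset.card_univ, Fintype.card_fin]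

lemma cellIn_of_le {lam : Nat.Partition r} {c d : ℕ × ℕ} (h : cellIn lam d) (hcd : c ≤ d) :
    cellIn lam c :=
  (hcd.1.trans_lt h).trans_le (Multiset.card_le_card
    (Multiset.monotone_filter_right _ fun _ hp => hcd.2.trans_lt hp))

lemma exists_partition {S : Finset (ℕ × ℕ)} (hS : IsLow S) (hr : S.card = r) :
    ∃ lam : Nat.Partition r, ∀ c, c ∈ S ↔ cellIn lam c := by
  let μ : YoungDiagram := ⟨S, fun c d hdc hc => hS c hc d hdc⟩
  have hfib : ∀ a, (S.filter fun c => c.1 = a).card = μ.rowLen a := fun a =>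
    (μ.rowLen_eq_card (i := a)).symm
  refine ⟨⟨(S.image Prod.fst).val.map μ.rowLen, fun {k} hk => ?_, ?_⟩, fun c => ?_⟩
  · obtain ⟨a, ha, rfl⟩ := Multiset.mem_map.1 hk
    obtain ⟨c, hc, rfl⟩ := Finset.mem_image.1 ha
    exact (Nat.zero_le _).trans_lt (μ.mem_iff_lt_rowLen.1 (show (c.1, c.2) ∈ μ from hc))
  · change ∑ a ∈ S.image Prod.fst, μ.rowLen a = r
    rw [← hr, Finset.card_eq_sum_card_image Prod.fst S]
    exact Finset.sum_congr rfl fun a _ => (hfib a).symm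
  · rw [cellIn, Multiset.filter_map, Multiset.card_map]
    change _ ↔ c.1 < ((S.image Prod.fst).filter fun a => c.2 < μ.rowLen a).card
    have : ((S.image Prod.fst).filter fun a => c.2 < μ.rowLen a) = Finset.range (μ.colLen c.2) := by
      ext a
      rw [Finset.mem_filter, Finset.mem_range, ← μ.mem_iff_lt_rowLen, ← μ.mem_iff_lt_colLen]
      exact ⟨fun h => h.2, fun h => ⟨Finset.mem_image.2 ⟨(a, c.2), h, rfl⟩, h⟩⟩
    rw [this, Finset.card_range, ← μ.mem_iff_lt_colLen]
    rfl

lemma partition_ext {lam mu : Nat.Partition r} (h : ∀ c, cellIn lam c ↔ cellIn mu c) :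
    lam = mu := by
  have hcard : ∀ j, (lam.parts.filter fun p => j < p).card =
      (mu.parts.filter fun p => j < p).card :=
    fun j => eq_of_forall_lt_iff fun a => h (a, j)
  have hcount : ∀ (nu : Nat.Partition r) k, (nu.parts.filter fun p => k < p).card
      = nu.parts.count (k + 1) + (nu.parts.filter fun p => k + 1 < p).card := by
    intro nu k
    rw [Multiset.count_eq_card_filter_eq, ← Multiset.card_add]
    congr 1
    induction nu.parts using Multiset.induction_on with
    | empty => rfl
    | cons a s ih =>
      rw [Multiset.filter_cons, Multiset.filter_cons, Multiset.filter_cons, ih]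
      rcases lt_trichotomy a (k + 1) with h | h | h
      · rw [if_neg (by omega), if_neg (by omega), if_neg (by omega)]
        simp
      · rw [if_pos (by omega), if_pos (by omega), if_neg (by omega)]
        simp
      · rw [if_pos (by omega), if_neg (by omega), if_pos (by omega)]
        simp
  apply Nat.Partition.ext
  ext k
  rcases k with _ | k
  · rw [Multiset.count_eq_zero_of_notMem fun h => (lam.parts_pos h).ne rfl,
      Multiset.count_eq_zero_of_notMem fun h => (mu.parts_pos h).ne rfl]
  · have h₁ := hcount lam k
    have h₂ := hcount mu k
    rw [hcard, hcard] at h₁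
    omega

lemma fSYT_eq_card (lam : Nat.Partition r) :
    fSYT lam = Nat.card {p : Tab r // ∀ c, c ∈ shape p ↔ cellIn lam c} := by
  refine Nat.card_congr ?_
  have hmono : ∀ {f : {c : ℕ × ℕ // cellIn lam c} → Fin r},
      (∀ c d : {c : ℕ × ℕ // cellIn lam c}, c.1.1 = d.1.1 → c.1.2 < d.1.2 → f c < f d) →
      (∀ c d : {c : ℕ × ℕ // cellIn lam c}, c.1.2 = d.1.2 → c.1.1 < d.1.1 → f c < f d) →
      ∀ c d : {c : ℕ × ℕ // cellIn lam c}, c.1 ≤ d.1 → f c ≤ f d := by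
    intro f h₁ h₂ c d hcd
    have he : cellIn lam (c.1.1, d.1.2) := cellIn_of_le d.2 ⟨hcd.1, le_rfl⟩
    refine le_trans (b := f ⟨_, he⟩) ?_ ?_
    · rcases hcd.2.eq_or_lt with h | h
      · exact le_of_eq (congrArg f (Subtype.ext (Prod.ext rfl h)))
      · exact (h₁ c ⟨_, he⟩ rfl h).le
    · rcases hcd.1.eq_or_lt with h | h
      · exact le_of_eq (congrArg f (Subtype.ext (Prod.ext h rfl)))
      · exact (h₂ ⟨_, he⟩ d rfl h).le
  refine Equiv.ofBijective (fun f => ⟨⟨fun j => ((Equiv.ofBijective f.1 f.2.1).symm j).1,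
    ⟨fun i j h => (Equiv.injective _) (Subtype.ext h), fun j c hc => ?_⟩⟩, fun c => ?_⟩)
    ⟨fun f g h => ?_, fun p => ?_⟩
  · refine ⟨f.1 ⟨c, cellIn_of_le (Subtype.property _) hc⟩, ?_, ?_⟩
    · exact (hmono f.2.2.1 f.2.2.2 ⟨c, cellIn_of_le (Subtype.property _) hc⟩
        ((Equiv.ofBijective f.1 f.2.1).symm j) hc).trans_eq
        (Equiv.ofBijective_apply_symm_apply f.1 f.2.1 j)
    · rw [Equiv.ofBijective_symm_apply_apply]
  · rw [mem_shape]
    refine ⟨fun ⟨j, hj⟩ => hj ▸ Subtype.property _, fun h => ⟨f.1 ⟨c, h⟩, ?_⟩⟩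
    simp only
    rw [Equiv.ofBijective_symm_apply_apply]
  · have h' : ∀ j, (Equiv.ofBijective f.1 f.2.1).symm j = (Equiv.ofBijective g.1 g.2.1).symm j :=
      fun j => Subtype.ext (congrFun (congrArg (fun p => p.1.1) h) j)
    refine Subtype.ext (funext fun c => ?_)
    have := h' (f.1 c)
    rw [Equiv.ofBijective_symm_apply_apply, Equiv.eq_symm_apply] at this
    exact this.symm
  · obtain ⟨p, hp⟩ := p
    choose f hf using fun c : {c : ℕ × ℕ // cellIn lam c} => mem_shape.1 ((hp c.1).2 c.2)
    have hlt : ∀ c d : {c : ℕ × ℕ // cellIn lam c}, c.1 ≤ d.1 → c.1 ≠ d.1 → f c < f d := by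
      intro c d h₁ h₂
      refine lt_of_le_of_ne (p.2.le_of_le (by rwa [hf, hf])) fun e => h₂ ?_
      rw [← hf, ← hf, e]
    have hsurj : ∀ j, f ⟨p.1 j, (hp _).1 (mem_shape.2 ⟨j, rfl⟩)⟩ = j := fun j =>
      p.2.inj (hf _)
    have hbij : Function.Bijective f :=
      ⟨fun c d h => Subtype.ext (by rw [← hf, ← hf, h]), fun j => ⟨_, hsurj j⟩⟩
    refine ⟨⟨f, hbij, fun c d h₁ h₂ => hlt c d ⟨h₁.le, h₂.le⟩ fun e => h₂.ne (by rw [e]),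
      fun c d h₁ h₂ => hlt c d ⟨h₂.le, h₁.le⟩ fun e => h₂.ne (by rw [e])⟩, ?_⟩
    refine Subtype.ext (Subtype.ext (funext fun j => ?_))
    change ((Equiv.ofBijective f hbij).symm j).1 = p.1 j
    have : (Equiv.ofBijective f hbij).symm j = ⟨p.1 j, (hp _).1 (mem_shape.2 ⟨j, rfl⟩)⟩ := by
      rw [Equiv.symm_apply_eq]
      exact (hsurj j).symm
    rw [this]

lemma card_tabPair_hook (m n : ℕ) :
    Nat.card (TabPair r fun S => (m, n) ∉ S) = ∑ lam ∈ hookFinset m n r, fSYT lam ^ 2 := by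
  classical
  choose Λ hΛ using fun p : Tab r => exists_partition (isLow_shape p) (card_shape p)
  have hΛ' : ∀ p lam, (∀ c, c ∈ shape p ↔ cellIn lam c) ↔ Λ p = lam := fun p lam =>
    ⟨fun h => partition_ext fun c => (hΛ p c).symm.trans (h c), fun h => h ▸ hΛ p⟩
  have hshape : ∀ p q, shape p = shape q ↔ Λ p = Λ q := fun p q => by
    rw [← hΛ', Finset.ext_iff]
    simp only [hΛ]
  have hhook : ∀ p, (m, n) ∉ shape p ↔ Λ p ∈ hookFinset m n r := fun p => by
    rw [hΛ, cellIn, not_lt, hookFinset, Finset.mem_filter, and_iff_right (Finset.mem_univ _)]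
  have hf : ∀ lam, fSYT lam = (Finset.univ.filter fun p => Λ p = lam).card := fun lam => by
    rw [fSYT_eq_card, Nat.card_eq_fintype_card, Fintype.card_subtype]
    simp only [hΛ']
  rw [Nat.card_eq_fintype_card, Fintype.card_subtype]
  simp only [hshape, hhook]
  rw [Finset.card_eq_sum_card_fiberwise (f := fun pq => Λ pq.1) (t := hookFinset m n r)
    fun pq h => (Finset.mem_filter.1 h).2.2]
  refine Finset.sum_congr rfl fun lam hlam => ?_
  rw [hf, sq, ← Finset.card_product]
  congr 1
  ext pq
  simp only [Finset.mem_filter, Finset.mem_univ, true_and, Finset.mem_product]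
  constructor
  · rintro ⟨⟨h₁, _⟩, h₂⟩
    exact ⟨h₂, h₁ ▸ h₂⟩
  · rintro ⟨h₁, h₂⟩
    exact ⟨⟨h₁.trans h₂.symm, h₁ ▸ hlam⟩, h₁⟩

end Partitions

lemma generic_of_transcendental {t : ℂ} (ht : Transcendental ℚ t) : Generic t where
  ne_zero h := ht (h ▸ isAlgebraic_zero)
  pow_ne_one _ hk h := ht (IsAlgebraic.of_pow hk (h ▸ isAlgebraic_one))

end HookSchurWeyl

/-- For `t ∈ ℂ` transcendental over `ℚ`,
`dim_ℂ 𝒮_t = Σ_{λ ∈ H(m,n;r)} (f^λ)²`. -/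
theorem dim_St_eq_hook_sum (t : ℂ) (ht : Transcendental ℚ t)
    (m n r : ℕ) (hm : 1 ≤ m) (hn : 1 ≤ n) (hr : 2 ≤ r) :
    Module.finrank ℂ (St t m n r) = ∑ lam ∈ hookFinset m n r, fSYT lam ^ 2 := by
  obtain ⟨R, rfl⟩ : ∃ R, r = R + 1 := ⟨r - 1, by omega⟩
  rw [HookSchurWeyl.finrank_St (HookSchurWeyl.generic_of_transcendental ht),
    HookSchurWeyl.card_tabPair_hook]
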